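/- arXiv:2004.14057 — 2 statements merged into one kernel-verified Lean document; each statement's English description precedes it below -/
import Mathlib

section
/- Assume that the demand function D̄ : [0,T] → ℝ has bounded variation on [0,T]. Let (ωⁿ) and (ω̂ⁿ) be sequences in A(ω₀) converging weakly to ω and ω̂ in A(ω₀) respectively, and let (ηⁿ) and (η̂ⁿ) be sequences in Ā(η₀) converging weakly to η and η̂ in Ā(η₀) respectively. Then there exists a subsequence along which simultaneously ∫₀ᵀ ∫_Ω e^{−ρt}[G(P_t(ωⁿ_t, ηⁿ_t) − x) + f_C(t)] ω̂ⁿ_t(dx) dt → ∫₀ᵀ ∫_Ω e^{−ρt}[G(P_t(ω_t, η_t) − x) + f_C(t)] ω̂_t(dx) dt and ∫₀ᵀ ∫_Ω̄ e^{−ρt}[−P_t(ωⁿ_t, ηⁿ_t) x + f_R(t)] η̂ⁿ_t(dx) dt → ∫₀ᵀ ∫_Ω̄ e^{−ρt}[−P_t(ω_t, η_t) x + f_R(t)] η̂_t(dx) dt. -/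
open MeasureTheory Set Filter
open scoped Classical

noncomputable section

/-- A flow of positive bounded measures on the state space `S`: each `m t` is a finite
positive measure supported on `S`, `t ↦ m t B` is measurable for every Borel `B`, and
the total mass is integrable on `[0,T]`. -/
def IsMeasFlow (T : ℝ) (S : Set ℝ) (m : ℝ → Measure ℝ) : Prop :=
  (∀ t, IsFiniteMeasure (m t)) ∧
  (∀ t, m t Sᶜ = 0) ∧
  (∀ B : Set ℝ, MeasurableSet B → Measurable fun t => m t B) ∧
  IntegrableOn (fun t => (m t Set.univ).toReal) (Icc 0 T)

/-- The generator `k(θ-x)∂_x + b(x)∂_xx` applied via derivative witnesses. -/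
def gen (k θ : ℝ) (b : ℝ → ℝ) (ux uxx : ℝ → ℝ → ℝ) (t x : ℝ) : ℝ :=
  k * (θ - x) * ux t x + b x * uxx t x

/-- The Fokker–Planck inequality defining admissible flows: for every nonnegative
`C^{1,2}` function `u` on `[0,T] × S` with bounded `∂_t u + L u`, one has
`∫ u(0,·) dm₀ + ∫₀ᵀ ∫ (∂_t u + L u) dm_t dt ≥ 0`. -/
def FPineq (T k θ : ℝ) (b : ℝ → ℝ) (S : Set ℝ) (m₀ : Measure ℝ)
    (m : ℝ → Measure ℝ) : Prop :=
  ∀ u ut ux uxx : ℝ → ℝ → ℝ,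
    ContinuousOn (fun p : ℝ × ℝ => u p.1 p.2) (Icc 0 T ×ˢ S) →
    ContinuousOn (fun p : ℝ × ℝ => ut p.1 p.2) (Icc 0 T ×ˢ S) →
    ContinuousOn (fun p : ℝ × ℝ => ux p.1 p.2) (Icc 0 T ×ˢ S) →
    ContinuousOn (fun p : ℝ × ℝ => uxx p.1 p.2) (Icc 0 T ×ˢ S) →
    (∀ t ∈ Icc (0:ℝ) T, ∀ x ∈ S, HasDerivAt (fun s => u s x) (ut t x) t) →
    (∀ t ∈ Icc (0:ℝ) T, ∀ x ∈ S, HasDerivAt (fun y => u t y) (ux t x) x) →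
    (∀ t ∈ Icc (0:ℝ) T, ∀ x ∈ S, HasDerivAt (fun y => ux t y) (uxx t x) x) →
    (∀ t ∈ Icc (0:ℝ) T, ∀ x ∈ S, 0 ≤ u t x) →
    (∃ M : ℝ, ∀ t ∈ Icc (0:ℝ) T, ∀ x ∈ S, |ut t x + gen k θ b ux uxx t x| ≤ M) →
    0 ≤ (∫ x, u 0 x ∂m₀) +
        ∫ t in Icc (0:ℝ) T, (∫ x, (ut t x + gen k θ b ux uxx t x) ∂(m t))

/-- Admissible flows started from `m₀`. -/
def Admissible (T k θ : ℝ) (b : ℝ → ℝ) (S : Set ℝ) (m₀ : Measure ℝ)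
    (m : ℝ → Measure ℝ) : Prop :=
  IsMeasFlow T S m ∧ FPineq T k θ b S m₀ m

/-- The set `A(ω₀)` of the conventional producers (CIR generator, state space `Ω = [0,∞)`). -/
def AdmC (T k θ δ : ℝ) (ω₀ : Measure ℝ) (ω : ℝ → Measure ℝ) : Prop :=
  Admissible T k θ (fun x => δ ^ 2 * x / 2) (Ici 0) ω₀ ω

/-- The set `Ā(η₀)` of the renewable producers (Jacobi generator, state space `Ω̄ = [0,1]`). -/
def AdmR (T kb θb δb : ℝ) (η₀ : Measure ℝ) (η : ℝ → Measure ℝ) : Prop :=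
  Admissible T kb θb (fun x => δb ^ 2 * x * (1 - x) / 2) (Icc 0 1) η₀ η

/-- The set of admissible prices `{P ≥ 0 : (D - R)₊ ≤ ∫ F(P-x) ω(dx) + F₀(P)}`. -/
def priceSet (F F₀ : ℝ → ℝ) (D R : ℝ) (ω : Measure ℝ) : Set ℝ :=
  {P : ℝ | 0 ≤ P ∧ max (D - R) 0 ≤ (∫ x, F (P - x) ∂ω) + F₀ P}

/-- The market price: the infimum of admissible prices capped at `Pbar`, with the
convention `inf ∅ = +∞` (so the price equals `Pbar` when the set is empty). -/
def price (F F₀ : ℝ → ℝ) (Pbar D R : ℝ) (ω : Measure ℝ) : ℝ :=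
  if (priceSet F F₀ D R ω).Nonempty then min (sInf (priceSet F F₀ D R ω)) Pbar else Pbar

/-- Renewable production `R = ∫ x (η̄ - η)(dx)`. -/
def Rval (ηbar η : Measure ℝ) : ℝ := (∫ x, x ∂ηbar) - ∫ x, x ∂η

/-- The price trajectory `t ↦ P_t(ω_t, η_t)`. -/
def priceT (F F₀ : ℝ → ℝ) (Pbar : ℝ) (D : ℝ → ℝ) (ηbar ω η : ℝ → Measure ℝ)
    (t : ℝ) : ℝ :=
  price F F₀ Pbar (D t) (Rval (ηbar t) (η t)) (ω t)

/-- Weak convergence of flows of measures: the measures `mⁿ_t(dx) dt` on `[0,T] × ℝ`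
converge weakly to `m_t(dx) dt`, tested against bounded continuous functions. -/
def WeakConvFlow (T : ℝ) (mseq : ℕ → ℝ → Measure ℝ) (m : ℝ → Measure ℝ) : Prop :=
  ∀ φ : ℝ × ℝ → ℝ, Continuous φ → (∃ M, ∀ p, |φ p| ≤ M) →
    Tendsto (fun n => ∫ t in Icc (0:ℝ) T, ∫ x, φ (t, x) ∂(mseq n t)) atTop
      (nhds (∫ t in Icc (0:ℝ) T, ∫ x, φ (t, x) ∂(m t)))


lemma aux_conv (T K : ℝ) (g : ℕ → ℝ → ℝ) (g' : ℝ → ℝ)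
    (hgi : ∀ n, IntervalIntegrable (g n) volume 0 T) (hg' : IntervalIntegrable g' volume 0 T)
    (hT : 0 < T)
    (hslope : ∀ n a t b, 0 ≤ a → a < t → t < b → b ≤ T →
      (∫ x in t..b, g n x) / (b - t) ≤ (∫ x in a..t, g n x) / (t - a) + K * (b - a))
    (hconv : ∀ a b, 0 ≤ a → a ≤ b → b ≤ T →
      Tendsto (fun n => ∫ x in a..b, g n x) atTop (nhds (∫ x in a..b, g' x))) :
    ∀ᵐ t ∂(volume.restrict (Icc 0 T)), Tendsto (fun n => g n t) atTop (nhds (g' t)) := by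
  -- averages
  have key : ∀ f : ℝ → ℝ, IntervalIntegrable f volume 0 T → ∀ t ∈ Ioo 0 T,
      HasDerivAt (fun x => ∫ s in (0:ℝ)..x, f s) (f t) t →
      Tendsto (fun b => (∫ x in t..b, f x) / (b - t)) (nhdsWithin t (Ioi t)) (nhds (f t)) ∧
      Tendsto (fun a => (∫ x in a..t, f x) / (t - a)) (nhdsWithin t (Iio t)) (nhds (f t)) := by
    intro f hf t ht hd
    have hsl := hasDerivAt_iff_tendsto_slope.1 hd
    have hii : ∀ x ∈ Ioo 0 T, IntervalIntegrable f volume 0 x := by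
      intro x hx
      apply hf.mono_set
      rw [uIcc_of_le hx.1.le, uIcc_of_le hT.le]
      exact Icc_subset_Icc le_rfl hx.2.le
    have hev : ∀ᶠ x in nhds t, x ∈ Ioo 0 T := isOpen_Ioo.mem_nhds ht
    constructor
    · refine (hsl.mono_left (nhdsWithin_mono _ (fun x hx => ne_of_gt hx))).congr' ?_
      filter_upwards [nhdsWithin_le_nhds hev] with x hx
      rw [slope_def_field, intervalIntegral.integral_interval_sub_left (hii x hx) (hii t ht)]
    · refine (hsl.mono_left (nhdsWithin_mono _ (fun x hx => ne_of_lt hx))).congr' ?_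
      filter_upwards [nhdsWithin_le_nhds hev] with x hx
      rw [slope_comm, slope_def_field,
        intervalIntegral.integral_interval_sub_left (hii t ht) (hii x hx)]
  have hd : ∀ᵐ t ∂(volume : Measure ℝ), ∀ n, t ∈ uIcc 0 T → ∀ c ∈ uIcc 0 T,
      HasDerivAt (fun x => ∫ s in c..x, g n s) (g n t) t :=
    ae_all_iff.2 fun n => (hgi n).ae_hasDerivAt_integral
  rw [Measure.restrict_congr_set Ioo_ae_eq_Icc.symm]
  rw [ae_restrict_iff' measurableSet_Ioo]
  filter_upwards [hd, hg'.ae_hasDerivAt_integral] with t h1 h2 ht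
  have htu : t ∈ uIcc 0 T := by rw [uIcc_of_le hT.le]; exact ⟨ht.1.le, ht.2.le⟩
  have h0u : (0:ℝ) ∈ uIcc 0 T := left_mem_uIcc
  have hn := fun n => key (g n) (hgi n) t ht (h1 n htu 0 h0u)
  have hl := key g' hg' t ht (h2 htu 0 h0u)
  have up : ∀ n, ∀ a, 0 ≤ a → a < t → g n t ≤ (∫ x in a..t, g n x) / (t - a) + K * (t - a) := by
    intro n a ha hat
    have hr : Tendsto (fun b => (∫ x in a..t, g n x) / (t - a) + K * (b - a))
        (nhdsWithin t (Ioi t)) (nhds ((∫ x in a..t, g n x) / (t - a) + K * (t - a))) :=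
      (Continuous.tendsto (by fun_prop) t).mono_left nhdsWithin_le_nhds
    refine le_of_tendsto_of_tendsto (hn n).1 hr ?_
    filter_upwards [Ioo_mem_nhdsGT ht.2] with b hb
    exact hslope n a t b ha hat hb.1 hb.2.le
  have lo : ∀ n, ∀ b, t < b → b ≤ T → (∫ x in t..b, g n x) / (b - t) - K * (b - t) ≤ g n t := by
    intro n b htb hbT
    have hr : Tendsto (fun a => (∫ x in a..t, g n x) / (t - a) + K * (b - a))
        (nhdsWithin t (Iio t)) (nhds (g n t + K * (b - t))) :=
      (hn n).2.add ((Continuous.tendsto (by fun_prop) t).mono_left nhdsWithin_le_nhds)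
    have : (∫ x in t..b, g n x) / (b - t) ≤ g n t + K * (b - t) := by
      refine ge_of_tendsto hr ?_
      filter_upwards [Ioo_mem_nhdsLT ht.1] with a ha
      exact hslope n a t b ha.1.le ha.2 htb hbT
    linarith
  rw [tendsto_order]
  constructor
  · intro c hc
    have hr : Tendsto (fun b => (∫ x in t..b, g' x) / (b - t) - K * (b - t))
        (nhdsWithin t (Ioi t)) (nhds (g' t - K * (t - t))) :=
      hl.1.sub ((Continuous.tendsto (by fun_prop) t).mono_left nhdsWithin_le_nhds)
    have h3 := hr.eventually (lt_mem_nhds (show c < g' t - K * (t - t) by simpa using hc))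
    obtain ⟨b, hb, hb2⟩ := (h3.and (Ioo_mem_nhdsGT ht.2)).exists
    have h4 := ((hconv t b ht.1.le hb2.1.le hb2.2.le).div_const (b - t)).sub_const (K * (b - t))
    filter_upwards [h4.eventually (lt_mem_nhds hb)] with n hn
    exact hn.trans_le (lo n b hb2.1 hb2.2.le)
  · intro c hc
    have hr : Tendsto (fun a => (∫ x in a..t, g' x) / (t - a) + K * (t - a))
        (nhdsWithin t (Iio t)) (nhds (g' t + K * (t - t))) :=
      hl.2.add ((Continuous.tendsto (by fun_prop) t).mono_left nhdsWithin_le_nhds)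
    have h3 := hr.eventually (gt_mem_nhds (show g' t + K * (t - t) < c by simpa using hc))
    obtain ⟨a, ha, ha2⟩ := (h3.and (Ioo_mem_nhdsLT ht.1)).exists
    have h4 := ((hconv a t ha2.1.le ha2.2.le ht.2.le).div_const (t - a)).add_const (K * (t - a))
    filter_upwards [h4.eventually (gt_mem_nhds ha)] with n hn
    exact (up n a ha2.1.le ha2.2).trans_lt hn

lemma aux_err (T A e : ℝ) (χ ζ g : ℝ → ℝ) (hχ : Integrable χ) (hζ : Integrable ζ)
    (he : ∫ x, ‖χ x - ζ x‖ ≤ e) (hA : 0 ≤ A)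
    (hgm : AEStronglyMeasurable g (volume.restrict (Icc 0 T)))
    (hg : ∀ᵐ t ∂(volume.restrict (Icc 0 T)), |g t| ≤ A) :
    |(∫ t in Icc 0 T, χ t * g t) - ∫ t in Icc 0 T, ζ t * g t| ≤ A * e := by
  have i1 : ∀ χ : ℝ → ℝ, Integrable χ → Integrable (fun t => χ t * g t)
      (volume.restrict (Icc 0 T)) := fun χ hχ =>
    hχ.restrict.mul_bdd (c := A) hgm hg
  rw [← integral_sub (i1 χ hχ) (i1 ζ hζ)]
  have hd : Integrable (fun x => ‖χ x - ζ x‖) := (hχ.sub hζ).norm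
  calc _ ≤ ∫ t in Icc 0 T, A * ‖χ t - ζ t‖ := by
        refine norm_integral_le_of_norm_le (f := fun t => χ t * g t - ζ t * g t) (hd.restrict.const_mul A) ?_
        filter_upwards [hg] with t ht
        rw [← sub_mul, norm_mul, mul_comm]
        exact mul_le_mul_of_nonneg_right ht (norm_nonneg _)
    _ = A * ∫ t in Icc 0 T, ‖χ t - ζ t‖ := integral_const_mul _ _
    _ ≤ A * e := by
        refine mul_le_mul_of_nonneg_left (le_trans ?_ he) hA
        exact setIntegral_le_integral hd (Eventually.of_forall fun _ => norm_nonneg _)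

lemma aux_indicator (a b r : ℝ) : Integrable ((Ioc a b).indicator (fun _ => r)) := by
  rw [integrable_indicator_iff measurableSet_Ioc]
  exact integrableOn_const (by simp)

lemma aux_ind_int (T a b r : ℝ) (g : ℝ → ℝ) (ha : 0 ≤ a) (hab : a ≤ b) (hb : b ≤ T) :
    ∫ t in Icc 0 T, (Ioc a b).indicator (fun _ => r) t * g t = r * ∫ t in a..b, g t := by
  have : (fun t => (Ioc a b).indicator (fun _ => r) t * g t)
      = (Ioc a b).indicator (fun t => r * g t) := by
    ext t; by_cases h : t ∈ Ioc a b <;> simp [h]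
  rw [this, setIntegral_indicator measurableSet_Ioc, inter_eq_right.2, intervalIntegral.integral_of_le hab,
    integral_const_mul]
  exact fun x hx => ⟨ha.trans hx.1.le, hx.2.trans hb⟩

lemma aux_weak (T A : ℝ) (g : ℕ → ℝ → ℝ) (g' : ℝ → ℝ) (hA : 0 ≤ A)
    (hgm : ∀ n, AEStronglyMeasurable (g n) (volume.restrict (Icc 0 T)))
    (hg : ∀ n, ∀ᵐ t ∂(volume.restrict (Icc 0 T)), |g n t| ≤ A)
    (hgm' : AEStronglyMeasurable g' (volume.restrict (Icc 0 T)))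
    (hg' : ∀ᵐ t ∂(volume.restrict (Icc 0 T)), |g' t| ≤ A)
    (hw : ∀ ζ : ℝ → ℝ, Continuous ζ → (∃ M, ∀ t, |ζ t| ≤ M) →
      Tendsto (fun n => ∫ t in Icc 0 T, ζ t * g n t) atTop (nhds (∫ t in Icc 0 T, ζ t * g' t)))
    (a b : ℝ) (ha : 0 ≤ a) (hab : a ≤ b) (hb : b ≤ T) :
    Tendsto (fun n => ∫ x in a..b, g n x) atTop (nhds (∫ x in a..b, g' x)) := by
  have e1 : ∀ g : ℝ → ℝ, ∫ x in a..b, g x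
      = ∫ t in Icc 0 T, (Ioc a b).indicator (fun _ => (1:ℝ)) t * g t := by
    intro g; rw [aux_ind_int T a b 1 g ha hab hb, one_mul]
  simp_rw [e1]
  rw [Metric.tendsto_atTop]
  intro ε hε
  have hpos : 0 < ε / (3 * (A + 1)) := by positivity
  obtain ⟨ζ, h1, h2⟩ := (aux_indicator a b 1).exists_boundedContinuous_integral_sub_le hpos
  have hw1 := hw ζ ζ.continuous ⟨‖ζ‖, fun t => ζ.norm_coe_le_norm t⟩
  obtain ⟨N, hN⟩ := Metric.tendsto_atTop.1 hw1 (ε / 3) (by positivity)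
  refine ⟨N, fun n hn => ?_⟩
  have h3 := hN n hn
  have h4 := aux_err T A _ _ _ (g n) (aux_indicator a b 1) h2 h1 hA (hgm n) (hg n)
  have h5 := aux_err T A _ _ _ g' (aux_indicator a b 1) h2 h1 hA hgm' hg'
  have h6 : A * (ε / (3 * (A + 1))) < ε / 3 := by
    rw [mul_div_assoc', div_lt_div_iff₀ (by positivity) (by positivity)]
    nlinarith
  rw [Real.dist_eq] at *
  rw [abs_lt] at *
  rw [abs_le] at *
  constructor <;> linarith [h3.1, h3.2, h4.1, h4.2, h5.1, h5.2]

lemma aux_slope (T A C K : ℝ) (hT : 0 < T) (hA : 0 ≤ A) (hC : 0 ≤ C) (hK : 0 ≤ K) (g : ℝ → ℝ)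
    (hgm : AEStronglyMeasurable g (volume.restrict (Icc 0 T)))
    (hg : ∀ᵐ t ∂(volume.restrict (Icc 0 T)), |g t| ≤ A)
    (hFP : ∀ (ζ : ℝ → ℝ) (ψ₀ : ℝ), Continuous ζ → 0 ≤ ψ₀ →
      (∀ s ∈ Icc 0 T, 0 ≤ ψ₀ + ∫ r in (0:ℝ)..s, ζ r) →
      0 ≤ ψ₀ * C + (∫ t in Icc 0 T, ζ t * g t)
        + K * ∫ s in Icc 0 T, (ψ₀ + ∫ r in (0:ℝ)..s, ζ r))
    (a t b : ℝ) (ha : 0 ≤ a) (hat : a < t) (htb : t < b) (hb : b ≤ T) :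
    (∫ x in t..b, g x) / (b - t) ≤ (∫ x in a..t, g x) / (t - a) + K * (b - a) := by
  set χ : ℝ → ℝ := fun s => (Ioc a t).indicator (fun _ => (t - a)⁻¹) s
    - (Ioc t b).indicator (fun _ => (b - t)⁻¹) s with hχdef
  have hχ : Integrable χ := (aux_indicator _ _ _).sub (aux_indicator _ _ _)
  have hI : ∀ (a b r s : ℝ), 0 ≤ a → 0 ≤ s →
      ∫ x in (0:ℝ)..s, (Ioc a b).indicator (fun _ => r) x = max (min s b - a) 0 * r := by
    intro a b r s ha hs
    rw [intervalIntegral.integral_of_le hs, setIntegral_indicator measurableSet_Ioc,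
      Ioc_inter_Ioc, setIntegral_const, max_eq_right ha]
    simp
  have hΦ : ∀ s, 0 ≤ s → 0 ≤ ∫ x in (0:ℝ)..s, χ x ∧
      ∫ x in (0:ℝ)..s, χ x ≤ (Ioc a b).indicator (fun _ => (1:ℝ)) s := by
    intro s hs
    have : ∫ x in (0:ℝ)..s, χ x = max (min s t - a) 0 * (t - a)⁻¹
        - max (min s b - t) 0 * (b - t)⁻¹ := by
      rw [← hI a t _ s ha hs, ← hI t b _ s (ha.trans hat.le) hs]
      exact intervalIntegral.integral_sub (aux_indicator _ _ _).intervalIntegrable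
        (aux_indicator _ _ _).intervalIntegrable
    rw [this]
    have p1 : 0 < t - a := by linarith
    have p2 : 0 < b - t := by linarith
    rcases le_or_gt s a with h | h
    · have : s ∉ Ioc a b := fun h' => by linarith [h'.1]
      rw [min_eq_left (by linarith), min_eq_left (by linarith), max_eq_right (by linarith),
        max_eq_right (by linarith)]
      simp [this]
    rcases le_or_gt s t with h2 | h2
    · have : s ∈ Ioc a b := ⟨h, by linarith⟩
      rw [min_eq_left (by linarith), min_eq_left (by linarith), max_eq_left (by linarith),
        max_eq_right (by linarith)]
      simp only [this, indicator_of_mem, zero_mul, sub_zero]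
      rw [← div_eq_mul_inv]
      exact ⟨div_nonneg (by linarith) p1.le, (div_le_one p1).2 (by linarith)⟩
    rcases le_or_gt s b with h3 | h3
    · have : s ∈ Ioc a b := ⟨h, by linarith⟩
      rw [min_eq_right (by linarith), min_eq_left (by linarith), max_eq_left (by linarith),
        max_eq_left (by linarith)]
      simp only [this, indicator_of_mem, mul_inv_cancel₀ p1.ne', ← div_eq_mul_inv]
      have : (s - t) / (b - t) ≤ 1 := (div_le_one p2).2 (by linarith)
      have : 0 ≤ (s - t) / (b - t) := div_nonneg (by linarith) p2.le
      constructor <;> linarith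
    · have : s ∉ Ioc a b := fun h' => by linarith [h'.2]
      rw [min_eq_right (by linarith), min_eq_right (by linarith), max_eq_left (by linarith),
        max_eq_left (by linarith), mul_inv_cancel₀ p1.ne', mul_inv_cancel₀ p2.ne']
      simp [this]
  have hmain : ∀ e > 0, (∫ x in t..b, g x) / (b - t) ≤ (∫ x in a..t, g x) / (t - a) + K * (b - a)
      + e * (C + A + 2 * K * T) := by
    intro e he
    obtain ⟨ζ, h1, h2⟩ := hχ.exists_boundedContinuous_integral_sub_le he
    have hdiff : ∀ s, 0 ≤ s → |(∫ x in (0:ℝ)..s, χ x) - ∫ x in (0:ℝ)..s, ζ x| ≤ e := by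
      intro s hs
      rw [← intervalIntegral.integral_sub hχ.intervalIntegrable h2.intervalIntegrable]
      refine (intervalIntegral.abs_integral_le_integral_abs hs).trans (le_trans ?_ h1)
      rw [intervalIntegral.integral_of_le hs]
      exact setIntegral_le_integral (hχ.sub h2).norm (Eventually.of_forall fun _ => abs_nonneg _)
    have hpos : ∀ s ∈ Icc 0 T, 0 ≤ e + ∫ r in (0:ℝ)..s, ζ r := by
      intro s hs
      have := abs_le.1 (hdiff s hs.1)
      linarith [(hΦ s hs.1).1, this.2]
    have h3 := hFP ζ e ζ.continuous he.le hpos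
    have h4 := aux_err T A _ _ _ g hχ h2 h1 hA hgm hg
    have h5 : ∫ t in Icc 0 T, χ t * g t = (∫ x in a..t, g x) / (t - a)
        - (∫ x in t..b, g x) / (b - t) := by
      rw [div_eq_inv_mul, div_eq_inv_mul, ← aux_ind_int T a t _ g ha hat.le (by linarith),
        ← aux_ind_int T t b _ g (by linarith) htb.le hb, ← integral_sub]
      · simp only [hχdef, sub_mul]
      · exact (aux_indicator _ _ _).restrict.mul_bdd (c := A) hgm hg
      · exact (aux_indicator _ _ _).restrict.mul_bdd (c := A) hgm hg
    have h6 : ∫ s in Icc 0 T, (e + ∫ r in (0:ℝ)..s, ζ r) ≤ 2 * e * T + (b - a) := by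
      have hc : Continuous fun s => e + ∫ r in (0:ℝ)..s, ζ r :=
        continuous_const.add (intervalIntegral.continuous_primitive
          (fun a b => h2.intervalIntegrable) 0)
      calc _ ≤ ∫ s in Icc 0 T, (2 * e + (Ioc a b).indicator (fun _ => (1:ℝ)) s * 1) := by
            refine setIntegral_mono_on (hc.continuousOn.integrableOn_compact isCompact_Icc) ?_
              measurableSet_Icc ?_
            · refine Integrable.add (integrableOn_const (by simp)) ?_
              simpa using (aux_indicator a b 1).restrict
            · intro s hs
              have := abs_le.1 (hdiff s hs.1)
              linarith [(hΦ s hs.1).2, this.1]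
        _ = _ := by
            rw [integral_add, aux_ind_int T a b 1 (fun _ => 1) ha (by linarith) hb]
            · simp [hT.le]; ring
            · exact integrableOn_const (by simp)
            · simpa using (aux_indicator a b 1).restrict
    have h7 := mul_le_mul_of_nonneg_left h6 hK
    rw [h5] at h4
    have := (abs_le.1 h4).1
    nlinarith
  have hQ : 0 < C + A + 2 * K * T + 1 := by positivity
  refine le_of_forall_pos_le_add fun ε hε => ?_
  refine (hmain (ε / (C + A + 2 * K * T + 1)) (by positivity)).trans ?_
  have : ε / (C + A + 2 * K * T + 1) * (C + A + 2 * K * T) ≤ ε := by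
    rw [div_mul_eq_mul_div, div_le_iff₀ hQ]; nlinarith
  linarith

lemma flow_measurable {T : ℝ} {S : Set ℝ} {m : ℝ → Measure ℝ} (h : IsMeasFlow T S m) :
    Measurable m := Measure.measurable_of_measurable_coe m h.2.2.1

lemma flow_int_sm {T : ℝ} {S : Set ℝ} {m : ℝ → Measure ℝ} (h : IsMeasFlow T S m)
    (f : ℝ → ℝ) (hf : Measurable f) : StronglyMeasurable fun t => ∫ x, f x ∂(m t) := by
  let κ : ProbabilityTheory.Kernel ℝ ℝ := ⟨m, flow_measurable h⟩
  exact StronglyMeasurable.integral_kernel (κ := κ) hf.stronglyMeasurable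

lemma flow_mem {T : ℝ} {S : Set ℝ} {m : ℝ → Measure ℝ} (h : IsMeasFlow T S m) (t : ℝ) :
    ∀ᵐ x ∂(m t), x ∈ S := h.2.1 t

lemma fp_test {T k θ : ℝ} {b : ℝ → ℝ} {S : Set ℝ} {m₀ : Measure ℝ} {m : ℝ → Measure ℝ}
    (h : FPineq T k θ b S m₀ m) (f f' f'' : ℝ → ℝ) (A B : ℝ)
    (hf : ∀ x, HasDerivAt f (f' x) x) (hf' : ∀ x, HasDerivAt f' (f'' x) x) (hf'' : Continuous f'')
    (hpos : ∀ x ∈ S, 0 ≤ f x) (hA : ∀ x ∈ S, |f x| ≤ A)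
    (hB : ∀ x ∈ S, |k * (θ - x) * f' x + b x * f'' x| ≤ B)
    (ζ : ℝ → ℝ) (ψ₀ : ℝ) (hζ : Continuous ζ)
    (hψ : ∀ s ∈ Icc 0 T, 0 ≤ ψ₀ + ∫ r in (0:ℝ)..s, ζ r) :
    0 ≤ ψ₀ * (∫ x, f x ∂m₀) + ∫ t in Icc 0 T, ∫ x, (ζ t * f x + (ψ₀ + ∫ r in (0:ℝ)..t, ζ r) *
      (k * (θ - x) * f' x + b x * f'' x)) ∂(m t) := by
  set ψ : ℝ → ℝ := fun s => ψ₀ + ∫ r in (0:ℝ)..s, ζ r with hψdef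
  have hψd : ∀ s, HasDerivAt ψ (ζ s) s := fun s =>
    (intervalIntegral.integral_hasDerivAt_right (hζ.intervalIntegrable _ _)
      (hζ.stronglyMeasurableAtFilter _ _) hζ.continuousAt).const_add ψ₀
  have cψ : Continuous ψ := continuous_iff_continuousAt.2 fun s => (hψd s).continuousAt
  have cf : Continuous f := continuous_iff_continuousAt.2 fun s => (hf s).continuousAt
  have cf' : Continuous f' := continuous_iff_continuousAt.2 fun s => (hf' s).continuousAt
  obtain ⟨M1, hM1⟩ := isCompact_Icc.exists_bound_of_continuousOn (s := Icc 0 T) hζ.continuousOn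
  obtain ⟨M2, hM2⟩ := isCompact_Icc.exists_bound_of_continuousOn (s := Icc 0 T) cψ.continuousOn
  have e : ∀ t x, ζ t * f x + gen k θ b (fun t x => ψ t * f' x) (fun t x => ψ t * f'' x) t x =
      ζ t * f x + ψ t * (k * (θ - x) * f' x + b x * f'' x) := by
    intro t x; simp only [gen]; ring
  have := h (fun t x => ψ t * f x) (fun t x => ζ t * f x) (fun t x => ψ t * f' x)
    (fun t x => ψ t * f'' x)
    (by fun_prop) (by fun_prop) (by fun_prop) (by fun_prop)
    (fun t _ x _ => (hψd t).mul_const _)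
    (fun t _ x _ => (hf x).const_mul _)
    (fun t _ x _ => (hf' x).const_mul _)
    (fun t ht x hx => mul_nonneg (hψ t ht) (hpos x hx))
    ⟨M1 * A + M2 * B, fun t ht x hx => by
      rw [e]
      refine (abs_add_le _ _).trans ?_
      rw [abs_mul, abs_mul]
      have a1 := hM1 t ht
      have a2 := hM2 t ht
      rw [Real.norm_eq_abs] at a1 a2
      have := abs_nonneg (ζ t)
      have := abs_nonneg (ψ t)
      gcongr
      · linarith
      · exact hA x hx
      · linarith
      · exact hB x hx⟩
  simp only [e] at this
  rw [integral_const_mul] at this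
  have e0 : ψ 0 = ψ₀ := by simp [hψdef]
  rw [e0] at this
  exact this

lemma mass_bound {T k θ : ℝ} {b : ℝ → ℝ} {S : Set ℝ} {m₀ : Measure ℝ} {m : ℝ → Measure ℝ}
    (hT : 0 < T) (_ : IsFiniteMeasure m₀)
    (h : Admissible T k θ b S m₀ m) :
    ∀ᵐ t ∂(volume.restrict (Icc 0 T)), (m t).real univ ≤ m₀.real univ := by
  have hint : IntegrableOn (fun t => (m t).real univ) (Icc 0 T) := h.1.2.2.2
  have hii : IntervalIntegrable (fun t => (m t).real univ) volume 0 T := by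
    rw [intervalIntegrable_iff_integrableOn_Icc_of_le hT.le]; exact hint
  have h1 : ∀ ζ : ℝ → ℝ, Continuous ζ → (∀ t, 0 ≤ ζ t) →
      ∫ t in Icc 0 T, ζ t * (m t).real univ ≤ m₀.real univ * ∫ t in Icc 0 T, ζ t := by
    intro ζ hζ hp
    have := fp_test h.2 (fun _ => 1) (fun _ => 0) (fun _ => 0) 1 0
      (fun x => hasDerivAt_const _ _) (fun x => hasDerivAt_const _ _) continuous_const
      (by simp) (by simp) (by simp) (fun t => - ζ t) (∫ r in (0:ℝ)..T, ζ r) hζ.neg (by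
        intro s hs
        rw [intervalIntegral.integral_neg, ← sub_eq_add_neg,
          intervalIntegral.integral_interval_sub_left (hζ.intervalIntegrable _ _)
            (hζ.intervalIntegrable _ _)]
        exact intervalIntegral.integral_nonneg hs.2 fun x _ => hp x)
    simp only [mul_zero, add_zero, mul_one, integral_const, smul_eq_mul, mul_neg,
      integral_neg] at this
    rw [intervalIntegral.integral_of_le hT.le, ← integral_Icc_eq_integral_Ioc] at this
    have e : ∀ t, ζ t * (m t).real univ = (m t).real univ * ζ t := fun t => mul_comm _ _
    simp only [e]
    linarith
  have h2 : ∀ a b, 0 ≤ a → a < b → b ≤ T →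
      ∫ t in a..b, (m t).real univ ≤ m₀.real univ * (b - a) := by
    intro a b ha hab hb
    have h3 : ∀ δ > 0, ∫ t in a..b, (m t).real univ ≤ m₀.real univ * (b - a + 2 * δ) := by
      intro δ hδ
      set ζ : ℝ → ℝ := fun t => max 0 (min 1 (min ((t - (a - δ)) / δ) ((b + δ - t) / δ))) with hζdef
      have hζ : Continuous ζ := by fun_prop
      have hp : ∀ t, 0 ≤ ζ t := fun t => le_max_left _ _
      have hle : ∀ t, ζ t ≤ 1 := fun t => max_le zero_le_one (min_le_left _ _)
      have hone : ∀ t ∈ Ioc a b, ζ t = 1 := by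
        intro t ht
        have a1 : 1 ≤ (t - (a - δ)) / δ := by rw [le_div_iff₀ hδ]; linarith [ht.1]
        have a2 : 1 ≤ (b + δ - t) / δ := by rw [le_div_iff₀ hδ]; linarith [ht.2]
        simp only [hζdef]
        rw [min_eq_left (le_min a1 a2)]; simp
      have hz : ∀ t, ζ t ≤ (Icc (a - δ) (b + δ)).indicator (fun _ => (1:ℝ)) t := by
        intro t
        by_cases ht : t ∈ Icc (a - δ) (b + δ)
        · simp [ht, hle t]
        · simp only [ht, not_false_eq_true, indicator_of_notMem]
          refine max_le le_rfl ?_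
          simp only [mem_Icc, not_and_or, not_le] at ht
          rcases ht with ht | ht
          · exact (min_le_right _ _).trans ((min_le_left _ _).trans
              (div_nonpos_of_nonpos_of_nonneg (by linarith) hδ.le))
          · exact (min_le_right _ _).trans ((min_le_right _ _).trans
              (div_nonpos_of_nonpos_of_nonneg (by linarith) hδ.le))
      have hind : Integrable ((Icc (a - δ) (b + δ)).indicator (fun _ => (1:ℝ))) := by
        rw [integrable_indicator_iff measurableSet_Icc]
        exact integrableOn_const (by simp)
      calc ∫ t in a..b, (m t).real univ
          = ∫ t in Icc 0 T, (Ioc a b).indicator (fun _ => (1:ℝ)) t * (m t).real univ := by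
            rw [aux_ind_int T a b 1 _ ha hab.le hb, one_mul]
        _ ≤ ∫ t in Icc 0 T, ζ t * (m t).real univ := by
            refine integral_mono ?_ ?_ ?_
            · refine hint.bdd_mul (c := 1) (aux_indicator a b 1).aestronglyMeasurable.restrict
                (Eventually.of_forall fun t => ?_)
              by_cases ht : t ∈ Ioc a b <;> simp [ht]
            · refine hint.bdd_mul (c := 1) hζ.aestronglyMeasurable
                (Eventually.of_forall fun t => ?_)
              rw [Real.norm_eq_abs, abs_of_nonneg (hp t)]; exact hle t
            · intro t
              refine mul_le_mul_of_nonneg_right ?_ measureReal_nonneg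
              by_cases ht : t ∈ Ioc a b
              · simp [ht, hone t ht]
              · simp [ht, hp t]
        _ ≤ m₀.real univ * ∫ t in Icc 0 T, ζ t := h1 ζ hζ hp
        _ ≤ m₀.real univ * (b - a + 2 * δ) := by
            refine mul_le_mul_of_nonneg_left ?_ measureReal_nonneg
            calc ∫ t in Icc 0 T, ζ t ≤ ∫ t in Icc 0 T,
                  (Icc (a - δ) (b + δ)).indicator (fun _ => (1:ℝ)) t :=
                  integral_mono (hζ.continuousOn.integrableOn_compact isCompact_Icc)
                    hind.restrict hz
              _ ≤ ∫ t, (Icc (a - δ) (b + δ)).indicator (fun _ => (1:ℝ)) t :=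
                  setIntegral_le_integral hind (Eventually.of_forall fun t =>
                    indicator_nonneg (fun _ _ => zero_le_one) t)
              _ = b - a + 2 * δ := by
                  rw [integral_indicator measurableSet_Icc]
                  simp
                  rw [max_eq_left (by linarith)]; ring
    have hlim : Tendsto (fun δ : ℝ => m₀.real univ * (b - a + 2 * δ)) (nhdsWithin 0 (Ioi 0))
        (nhds (m₀.real univ * (b - a + 2 * 0))) :=
      (Continuous.tendsto (by fun_prop) 0).mono_left nhdsWithin_le_nhds
    have := ge_of_tendsto hlim (by filter_upwards [self_mem_nhdsWithin] with δ hδ using h3 δ hδ)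
    simpa using this
  rw [Measure.restrict_congr_set Ioo_ae_eq_Icc.symm]
  rw [ae_restrict_iff' measurableSet_Ioo]
  filter_upwards [hii.ae_hasDerivAt_integral] with t hd ht
  have htu : t ∈ uIcc 0 T := by rw [uIcc_of_le hT.le]; exact ⟨ht.1.le, ht.2.le⟩
  have hd := hasDerivAt_iff_tendsto_slope.1 (hd htu t htu)
  refine le_of_tendsto (hd.mono_left (nhdsWithin_mono _ (fun x (hx : x ∈ Ioi t) => ne_of_gt hx))) ?_
  filter_upwards [Ioo_mem_nhdsGT ht.2] with x hx
  rw [slope_def_field, intervalIntegral.integral_same, sub_zero, div_le_iff₀ (by linarith [hx.1])]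
  exact h2 t x ht.1.le hx.1 hx.2.le

lemma flow_int_bound {T A M : ℝ} {S : Set ℝ} {m : ℝ → Measure ℝ} (h : IsMeasFlow T S m)
    (f : ℝ → ℝ) (hA : ∀ x ∈ S, |f x| ≤ A) (hA0 : 0 ≤ A) (t : ℝ) (ht : (m t).real univ ≤ M) :
    |∫ x, f x ∂(m t)| ≤ A * M := by
  have := h.1 t
  refine (norm_integral_le_of_norm_le_const (f := f) (C := A) (μ := m t) ?_).trans ?_
  · filter_upwards [flow_mem h t] with x hx using hA x hx
  · exact mul_le_mul_of_nonneg_left ht hA0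

lemma flow_conv {T k θ : ℝ} {b : ℝ → ℝ} {S : Set ℝ} {m₀ : Measure ℝ} {m : ℕ → ℝ → Measure ℝ}
    {m' : ℝ → Measure ℝ} (hT : 0 < T) (hm₀ : IsFiniteMeasure m₀) (hm₀S : m₀ Sᶜ = 0)
    (hb : Measurable b)
    (h : ∀ n, Admissible T k θ b S m₀ (m n)) (h' : Admissible T k θ b S m₀ m')
    (hw : WeakConvFlow T m m') (f f' f'' fb : ℝ → ℝ) (A B : ℝ) (hA0 : 0 ≤ A) (hB0 : 0 ≤ B)
    (hf : ∀ x, HasDerivAt f (f' x) x) (hf' : ∀ x, HasDerivAt f' (f'' x) x) (hf'' : Continuous f'')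
    (hpos : ∀ x ∈ S, 0 ≤ f x) (hA : ∀ x ∈ S, |f x| ≤ A)
    (hB : ∀ x ∈ S, |k * (θ - x) * f' x + b x * f'' x| ≤ B)
    (hfb : Continuous fb) (hfbA : ∀ x, |fb x| ≤ A) (hfeq : ∀ x ∈ S, f x = fb x) :
    ∀ᵐ t ∂(volume.restrict (Icc 0 T)),
      Tendsto (fun n => ∫ x, f x ∂(m n t)) atTop (nhds (∫ x, f x ∂(m' t))) := by
  have cf : Continuous f := continuous_iff_continuousAt.2 fun s => (hf s).continuousAt
  have cf' : Continuous f' := continuous_iff_continuousAt.2 fun s => (hf' s).continuousAt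
  set M := m₀.real univ with hM
  have hM0 : 0 ≤ M := measureReal_nonneg
  have bd : ∀ q : ℝ → Measure ℝ, Admissible T k θ b S m₀ q →
      ∀ᵐ t ∂(volume.restrict (Icc 0 T)), |∫ x, f x ∂(q t)| ≤ A * M := by
    intro q hq
    filter_upwards [mass_bound hT hm₀ hq] with t ht using flow_int_bound hq.1 f hA hA0 t ht
  have sm : ∀ q : ℝ → Measure ℝ, Admissible T k θ b S m₀ q →
      AEStronglyMeasurable (fun t => ∫ x, f x ∂(q t)) (volume.restrict (Icc 0 T)) :=
    fun q hq => (flow_int_sm hq.1 f cf.measurable).aestronglyMeasurable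
  have ig : ∀ q : ℝ → Measure ℝ, Admissible T k θ b S m₀ q →
      IntervalIntegrable (fun t => ∫ x, f x ∂(q t)) volume 0 T := by
    intro q hq
    rw [intervalIntegrable_iff_integrableOn_Icc_of_le hT.le]
    exact Integrable.of_bound (sm q hq) (A * M) (bd q hq)
  refine aux_conv T (B * M) (fun n t => ∫ x, f x ∂(m n t)) (fun t => ∫ x, f x ∂(m' t))
    (fun n => ig _ (h n)) (ig _ h') hT ?_ ?_
  · intro n
    refine aux_slope T (A * M) (∫ x, f x ∂m₀) (B * M) hT (by positivity) ?_ (by positivity) _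
      (sm _ (h n)) (bd _ (h n)) ?_
    · refine integral_nonneg_of_ae ?_
      have : ∀ᵐ x ∂m₀, x ∈ S := hm₀S
      filter_upwards [this] with x hx using hpos x hx
    · intro ζ ψ₀ hζ hψ₀ hψ
      have h1 := fp_test (h n).2 f f' f'' A B hf hf' hf'' hpos hA hB ζ ψ₀ hζ hψ
      refine h1.trans ?_
      rw [add_assoc]
      refine add_le_add le_rfl ?_
      set ℓ : ℝ → ℝ := fun x => k * (θ - x) * f' x + b x * f'' x with hℓ
      have mℓ : Measurable ℓ := by
        have := cf'.measurable
        have := hf''.measurable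
        fun_prop
      have cψ : Continuous fun s => ψ₀ + ∫ r in (0:ℝ)..s, ζ r :=
        continuous_const.add (intervalIntegral.continuous_primitive
          (fun a b => hζ.intervalIntegrable _ _) 0)
      have iζ : Integrable ζ (volume.restrict (Icc 0 T)) :=
        hζ.continuousOn.integrableOn_compact isCompact_Icc
      have iψ : Integrable (fun s => ψ₀ + ∫ r in (0:ℝ)..s, ζ r) (volume.restrict (Icc 0 T)) :=
        cψ.continuousOn.integrableOn_compact isCompact_Icc
      have bℓ : ∀ᵐ t ∂(volume.restrict (Icc 0 T)), |∫ x, ℓ x ∂(m n t)| ≤ B * M := by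
        filter_upwards [mass_bound hT hm₀ (h n)] with t ht using
          flow_int_bound (h n).1 ℓ hB hB0 t ht
      have i1 : Integrable (fun t => ζ t * ∫ x, f x ∂(m n t)) (volume.restrict (Icc 0 T)) :=
        iζ.mul_bdd (c := A * M) (sm _ (h n)) (bd _ (h n))
      have i2 : Integrable (fun t => (ψ₀ + ∫ r in (0:ℝ)..t, ζ r) * ∫ x, ℓ x ∂(m n t))
          (volume.restrict (Icc 0 T)) :=
        iψ.mul_bdd (c := B * M) (flow_int_sm (h n).1 ℓ mℓ).aestronglyMeasurable bℓ
      have e : ∀ t, ∫ x, (ζ t * f x + (ψ₀ + ∫ r in (0:ℝ)..t, ζ r) * ℓ x) ∂(m n t)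
          = ζ t * (∫ x, f x ∂(m n t)) + (ψ₀ + ∫ r in (0:ℝ)..t, ζ r) * ∫ x, ℓ x ∂(m n t) := by
        intro t
        have := (h n).1.1 t
        rw [integral_add, integral_const_mul, integral_const_mul]
        · refine Integrable.const_mul ?_ _
          refine Integrable.of_bound cf.aestronglyMeasurable A ?_
          filter_upwards [flow_mem (h n).1 t] with x hx using hA x hx
        · refine Integrable.const_mul ?_ _
          refine Integrable.of_bound mℓ.aestronglyMeasurable B ?_
          filter_upwards [flow_mem (h n).1 t] with x hx using hB x hx
      refine (le_of_eq (integral_congr_ae (Eventually.of_forall e))).trans ?_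
      rw [integral_add i1 i2]
      refine add_le_add le_rfl ?_
      rw [← integral_const_mul]
      refine integral_mono_ae i2 (iψ.const_mul _) ?_
      filter_upwards [bℓ, ae_restrict_mem measurableSet_Icc] with t ht htI
      rw [mul_comm (B * M)]
      exact mul_le_mul_of_nonneg_left (abs_le.1 ht).2 (hψ t htI)
  · refine aux_weak T (A * M) _ _ (by positivity) (fun n => sm _ (h n)) (fun n => bd _ (h n))
      (sm _ h') (bd _ h') ?_
    rintro ζ hζ ⟨M1, hM1⟩
    have := hw (fun p => ζ p.1 * fb p.2) (by fun_prop) ⟨M1 * A, fun p => by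
      rw [abs_mul]
      exact mul_le_mul (hM1 _) (hfbA _) (abs_nonneg _) ((abs_nonneg _).trans (hM1 0))⟩
    have e : ∀ q : ℝ → Measure ℝ, Admissible T k θ b S m₀ q → ∀ t,
        ∫ x, ζ t * fb x ∂(q t) = ζ t * ∫ x, f x ∂(q t) := by
      intro q hq t
      rw [← integral_const_mul]
      refine integral_congr_ae ?_
      filter_upwards [flow_mem hq.1 t] with x hx
      simp only [hfeq x hx]
    simpa only [e _ (h _), e _ h'] using this

lemma inf_nonempty {c d : ℝ} {h : ℝ → ℝ} (hc : 0 < c) (hd : 0 ≤ d)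
    (hm : ∀ p q, 0 ≤ p → p ≤ q → h p + c * (q - p) ≤ h q) (h0 : 0 ≤ h 0) :
    {p : ℝ | 0 ≤ p ∧ d ≤ h p}.Nonempty := by
  refine ⟨d / c, by positivity, ?_⟩
  have := hm 0 (d / c) le_rfl (by positivity)
  rw [sub_zero, mul_div_cancel₀ _ hc.ne'] at this
  linarith

lemma inf_conv {c d : ℝ} {h : ℝ → ℝ} {dn : ℕ → ℝ} {hn : ℕ → ℝ → ℝ} (hc : 0 < c) (hd : 0 ≤ d)
    (hdn : ∀ n, 0 ≤ dn n)
    (hm : ∀ p q, 0 ≤ p → p ≤ q → h p + c * (q - p) ≤ h q) (h0 : 0 ≤ h 0)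
    (hmn : ∀ n p q, 0 ≤ p → p ≤ q → hn n p + c * (q - p) ≤ hn n q) (h0n : ∀ n, 0 ≤ hn n 0)
    (hdc : Tendsto dn atTop (nhds d))
    (hhc : ∀ q : ℚ, Tendsto (fun n => hn n q) atTop (nhds (h q))) :
    Tendsto (fun n => sInf {p : ℝ | 0 ≤ p ∧ dn n ≤ hn n p}) atTop
      (nhds (sInf {p : ℝ | 0 ≤ p ∧ d ≤ h p})) := by
  have bdd : ∀ (d : ℝ) (h : ℝ → ℝ), BddBelow {p : ℝ | 0 ≤ p ∧ d ≤ h p} :=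
    fun d h => ⟨0, fun p hp => hp.1⟩
  have nen := fun n => inf_nonempty hc (hdn n) (hmn n) (h0n n)
  rw [tendsto_order]
  constructor
  · intro a ha
    by_cases ha0 : a < 0
    · refine Eventually.of_forall fun n => ha0.trans_le ?_
      exact le_csInf (nen n) fun p hp => hp.1
    obtain ⟨q, hq1, hq2⟩ := exists_rat_btwn ha
    have hq0 : (0:ℝ) ≤ q := by linarith [not_lt.1 ha0]
    have h1 : h q < d := by
      by_contra hcon
      exact absurd (csInf_le (bdd d h) ⟨hq0, not_lt.1 hcon⟩) (not_le.2 hq2)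
    filter_upwards [(hhc q).eventually_lt hdc h1] with n hn1
    refine hq1.trans_le (le_csInf (nen n) fun p hp => ?_)
    by_contra hcon
    have := hmn n p q hp.1 (not_le.1 hcon).le
    have := hp.2
    have := mul_nonneg hc.le (sub_nonneg.2 (not_le.1 hcon).le)
    linarith
  · intro a ha
    obtain ⟨p, hp, hpa⟩ := exists_lt_of_csInf_lt (inf_nonempty hc hd hm h0) ha
    obtain ⟨q, hq1, hq2⟩ := exists_rat_btwn hpa
    have h1 : d < h q := by
      have := hm p q hp.1 hq1.le
      have := mul_pos hc (sub_pos.2 hq1)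
      linarith [hp.2]
    filter_upwards [hdc.eventually_lt (hhc q) h1] with n hn1
    exact (csInf_le (bdd _ _) ⟨hp.1.trans hq1.le, hn1.le⟩).trans_lt hq2

lemma inf_meas {c : ℝ} {d : ℝ → ℝ} {h : ℝ → ℝ → ℝ} (hc : 0 < c) (hd : ∀ t, 0 ≤ d t)
    (hm : ∀ t p q, 0 ≤ p → p ≤ q → h t p + c * (q - p) ≤ h t q) (h0 : ∀ t, 0 ≤ h t 0)
    (dm : Measurable d) (hh : ∀ q : ℝ, Measurable fun t => h t q) :
    Measurable fun t => sInf {p : ℝ | 0 ≤ p ∧ d t ≤ h t p} := by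
  refine measurable_of_Iio fun a => ?_
  have : (fun t => sInf {p : ℝ | 0 ≤ p ∧ d t ≤ h t p}) ⁻¹' Iio a
      = ⋃ q : ℚ, {t | (0 ≤ (q:ℝ) ∧ (q:ℝ) < a) ∧ d t ≤ h t q} := by
    ext t
    simp only [mem_preimage, mem_Iio, mem_iUnion, mem_ofPred_eq]
    constructor
    · intro ha
      obtain ⟨p, hp, hpa⟩ := exists_lt_of_csInf_lt (inf_nonempty hc (hd t) (hm t) (h0 t)) ha
      obtain ⟨q, hq1, hq2⟩ := exists_rat_btwn hpa
      refine ⟨q, ⟨hp.1.trans hq1.le, hq2⟩, ?_⟩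
      have := hm t p q hp.1 hq1.le
      have := mul_pos hc (sub_pos.2 hq1)
      linarith [hp.2]
    · rintro ⟨q, ⟨h1, h2⟩, h3⟩
      exact (csInf_le (s := {p : ℝ | 0 ≤ p ∧ d t ≤ h t p}) ⟨0, fun p hp => hp.1⟩ ⟨h1, h3⟩).trans_lt h2
  rw [this]
  refine MeasurableSet.iUnion fun q => ?_
  exact (MeasurableSet.const _).inter (measurableSet_le dm (hh q))

lemma gain_meas {T M : ℝ} {S : Set ℝ} {m : ℝ → Measure ℝ} (h : IsMeasFlow T S m)
    (hM : ∀ᵐ t ∂(volume.restrict (Icc 0 T)), (m t).real univ ≤ M)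
    (Ψ : ℝ → ℝ → ℝ → ℝ) (hΨ : Continuous fun p : ℝ × ℝ × ℝ => Ψ p.1 p.2.1 p.2.2)
    (p : ℝ → ℝ) (hp : AEStronglyMeasurable p (volume.restrict (Icc 0 T))) :
    AEStronglyMeasurable (fun t => ∫ x, Ψ (p t) t x ∂(m t)) (volume.restrict (Icc 0 T)) := by
  have mm := flow_measurable h
  have hreal : Measurable fun t => (m t).real univ :=
    (h.2.2.1 univ MeasurableSet.univ).ennreal_toReal
  let κ : ProbabilityTheory.Kernel ℝ ℝ :=
    ⟨fun t => if (m t).real univ ≤ M then m t else 0,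
      Measurable.ite (measurableSet_le hreal measurable_const) mm measurable_const⟩
  have hκ : ∀ t, κ t = if (m t).real univ ≤ M then m t else 0 := fun t => rfl
  have : ProbabilityTheory.IsFiniteKernel κ := by
    refine ⟨ENNReal.ofReal M, ENNReal.ofReal_lt_top, fun t => ?_⟩
    rw [hκ]
    split_ifs with ht
    · have := h.1 t
      exact (ENNReal.le_ofReal_iff_toReal_le (measure_ne_top _ _)
        (measureReal_nonneg.trans ht)).2 ht
    · simp
  have hsm : StronglyMeasurable fun t => ∫ x, Ψ (hp.mk p t) t x ∂(κ t) := by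
    refine StronglyMeasurable.integral_kernel_prod_right (f := fun t x => Ψ (hp.mk p t) t x) ?_
    have := hp.stronglyMeasurable_mk.measurable
    exact (hΨ.measurable.comp (f := fun z : ℝ × ℝ => (hp.mk p z.1, z.1, z.2))
      (by fun_prop)).stronglyMeasurable
  refine ⟨_, hsm, ?_⟩
  filter_upwards [hM, hp.ae_eq_mk] with t h1 h2
  rw [hκ, if_pos h1, h2]

lemma gain_lip {T M Q L : ℝ} {S : Set ℝ} {m : ℝ → Measure ℝ} (h : IsMeasFlow T S m)
    (hM : ∀ᵐ t ∂(volume.restrict (Icc 0 T)), (m t).real univ ≤ M) (hL : 0 ≤ L) (hQ : 0 ≤ Q)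
    (Ψ : ℝ → ℝ → ℝ → ℝ) (hΨ : Continuous fun p : ℝ × ℝ × ℝ => Ψ p.1 p.2.1 p.2.2)
    (hΨQ : ∀ p t x, |Ψ p t x| ≤ Q) (hΨL : ∀ p q t x, |Ψ p t x - Ψ q t x| ≤ L * |p - q|)
    (p q : ℝ → ℝ) (hp : Integrable p (volume.restrict (Icc 0 T)))
    (hq : Integrable q (volume.restrict (Icc 0 T))) :
    |(∫ t in Icc 0 T, ∫ x, Ψ (p t) t x ∂(m t)) - ∫ t in Icc 0 T, ∫ x, Ψ (q t) t x ∂(m t)|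
      ≤ L * M * ∫ t in Icc 0 T, |p t - q t| := by
  have ig : ∀ p : ℝ → ℝ, AEStronglyMeasurable p (volume.restrict (Icc 0 T)) →
      Integrable (fun t => ∫ x, Ψ (p t) t x ∂(m t)) (volume.restrict (Icc 0 T)) := by
    intro p hp
    refine Integrable.of_bound (gain_meas h hM Ψ hΨ p hp) (Q * M) ?_
    filter_upwards [hM] with t ht
    exact flow_int_bound h _ (fun x _ => hΨQ _ _ _) hQ t ht
  rw [← integral_sub (ig p hp.1) (ig q hq.1), ← integral_const_mul]
  refine norm_integral_le_of_norm_le (f := fun t => (∫ x, Ψ (p t) t x ∂(m t)) - ∫ x, Ψ (q t) t x ∂(m t))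
    ((hp.sub hq).abs.const_mul _) ?_
  filter_upwards [hM] with t ht
  have := h.1 t
  have ix : ∀ p : ℝ, Integrable (fun x => Ψ p t x) (m t) := by
    intro p
    refine Integrable.of_bound (Continuous.aestronglyMeasurable ?_) Q
      (Eventually.of_forall fun x => hΨQ _ _ _)
    exact hΨ.comp (f := fun x => (p, t, x)) (by fun_prop)
  rw [← integral_sub (ix _) (ix _)]
  refine (flow_int_bound h _ (fun x _ => hΨL (p t) (q t) t x) (by positivity) t ht).trans ?_
  nlinarith

lemma gain_conv {T M Q L Bp : ℝ} {S : Set ℝ} {m : ℕ → ℝ → Measure ℝ} {m' : ℝ → Measure ℝ}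
    (h : ∀ n, IsMeasFlow T S (m n)) (h' : IsMeasFlow T S m') (hM0 : 0 ≤ M)
    (hM : ∀ n, ∀ᵐ t ∂(volume.restrict (Icc 0 T)), (m n t).real univ ≤ M)
    (hM' : ∀ᵐ t ∂(volume.restrict (Icc 0 T)), (m' t).real univ ≤ M)
    (hw : WeakConvFlow T m m') (hL : 0 ≤ L) (hQ : 0 ≤ Q)
    (Ψ : ℝ → ℝ → ℝ → ℝ) (hΨ : Continuous fun p : ℝ × ℝ × ℝ => Ψ p.1 p.2.1 p.2.2)
    (hΨQ : ∀ p t x, |Ψ p t x| ≤ Q) (hΨL : ∀ p q t x, |Ψ p t x - Ψ q t x| ≤ L * |p - q|)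
    (P : ℕ → ℝ → ℝ) (P' : ℝ → ℝ)
    (hPm : ∀ n, AEStronglyMeasurable (P n) (volume.restrict (Icc 0 T)))
    (hPm' : AEStronglyMeasurable P' (volume.restrict (Icc 0 T)))
    (hPb : ∀ n t, |P n t| ≤ Bp) (hPb' : ∀ t, |P' t| ≤ Bp)
    (hP : ∀ᵐ t ∂(volume.restrict (Icc 0 T)), Tendsto (fun n => P n t) atTop (nhds (P' t))) :
    Tendsto (fun n => ∫ t in Icc 0 T, ∫ x, Ψ (P n t) t x ∂(m n t)) atTop
      (nhds (∫ t in Icc 0 T, ∫ x, Ψ (P' t) t x ∂(m' t))) := by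
  have iP : ∀ n, Integrable (P n) (volume.restrict (Icc 0 T)) := fun n =>
    Integrable.of_bound (hPm n) Bp (Eventually.of_forall (hPb n))
  have iP' : Integrable P' (volume.restrict (Icc 0 T)) :=
    Integrable.of_bound hPm' Bp (Eventually.of_forall hPb')
  have hl1 : Tendsto (fun n => ∫ t in Icc 0 T, |P n t - P' t|) atTop (nhds 0) := by
    have : Tendsto (fun n => ∫ t in Icc 0 T, |P n t - P' t|) atTop
        (nhds (∫ t in Icc 0 T, (0:ℝ))) := by
      refine tendsto_integral_of_dominated_convergence (fun _ => Bp + Bp)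
        (fun n => ((iP n).sub iP').abs.1) (integrable_const _) ?_ ?_
      · intro n
        refine Eventually.of_forall fun t => ?_
        rw [Real.norm_eq_abs, abs_abs]
        exact (abs_sub _ _).trans (add_le_add (hPb n t) (hPb' t))
      · filter_upwards [hP] with t ht
        have := (ht.sub_const (P' t)).abs
        simpa using this
    simpa using this
  rw [Metric.tendsto_atTop]
  intro ε hε
  have hpos : 0 < ε / (4 * (L * M + 1)) := by positivity
  obtain ⟨p, hp1, hp2⟩ := iP'.exists_boundedContinuous_integral_sub_le hpos
  have hw1 := hw (fun z => Ψ (p z.1) z.1 z.2)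
    (hΨ.comp (f := fun z : ℝ × ℝ => (p z.1, z.1, z.2)) (by fun_prop)) ⟨Q, fun _ => hΨQ _ _ _⟩
  obtain ⟨N1, hN1⟩ := Metric.tendsto_atTop.1 hw1 (ε / 4) (by positivity)
  obtain ⟨N2, hN2⟩ := Metric.tendsto_atTop.1 hl1 _ hpos
  refine ⟨max N1 N2, fun n hn => ?_⟩
  have a1 := hN1 n ((le_max_left _ _).trans hn)
  have a2 := hN2 n ((le_max_right _ _).trans hn)
  have b1 := gain_lip (h n) (hM n) hL hQ Ψ hΨ hΨQ hΨL (P n) P' (iP n) iP'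
  have b2 := gain_lip (h n) (hM n) hL hQ Ψ hΨ hΨQ hΨL P' p iP' hp2
  have b3 := gain_lip h' hM' hL hQ Ψ hΨ hΨQ hΨL P' p iP' hp2
  have hLM : 0 ≤ L * M := by positivity
  have h6 : L * M * (ε / (4 * (L * M + 1))) < ε / 4 := by
    rw [mul_div_assoc', div_lt_div_iff₀ (by positivity) (by positivity)]
    nlinarith
  rw [Real.dist_eq, sub_zero] at a2
  have c1 := mul_le_mul_of_nonneg_left ((le_abs_self _).trans a2.le) hLM
  have c2 := mul_le_mul_of_nonneg_left hp1 hLM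
  simp only [Real.norm_eq_abs] at c2
  rw [Real.dist_eq] at *
  rw [abs_lt] at *
  rw [abs_le] at b1 b2 b3
  constructor <;> linarith [a1.1, a1.2, b1.1, b1.2, b2.1, b2.2, b3.1, b3.2]

lemma supply_mono {F F₀ : ℝ → ℝ} {c : ℝ} (hFc : Continuous F) (hFmono : Monotone F)
    (hFrange : ∀ y, F y ∈ Icc (0:ℝ) 1)
    (hF₀slope : ∀ p h : ℝ, 0 ≤ p → 0 ≤ h → c * h ≤ F₀ (p + h) - F₀ p)
    (ω : Measure ℝ) (hω : IsFiniteMeasure ω) (p q : ℝ) (hp : 0 ≤ p) (hpq : p ≤ q) :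
    ((∫ x, F (p - x) ∂ω) + F₀ p) + c * (q - p) ≤ (∫ x, F (q - x) ∂ω) + F₀ q := by
  have h1 := hF₀slope p (q - p) hp (by linarith)
  rw [add_sub_cancel] at h1
  have ii : ∀ p, Integrable (fun x => F (p - x)) ω := fun p =>
    Integrable.of_bound (Continuous.aestronglyMeasurable (by fun_prop)) 1
      (Eventually.of_forall fun x => by
        rw [Real.norm_eq_abs, abs_of_nonneg (hFrange _).1]; exact (hFrange _).2)
  have h2 : ∫ x, F (p - x) ∂ω ≤ ∫ x, F (q - x) ∂ω :=
    integral_mono (ii p) (ii q) fun x => hFmono (by linarith)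
  linarith

lemma supply_zero {F F₀ : ℝ → ℝ} (hFrange : ∀ y, F y ∈ Icc (0:ℝ) 1)
    (hF₀zero : F₀ 0 = 0) (ω : Measure ℝ) : 0 ≤ (∫ x, F (0 - x) ∂ω) + F₀ 0 := by
  rw [hF₀zero, add_zero]
  exact integral_nonneg fun x => (hFrange _).1

lemma price_eq {F F₀ : ℝ → ℝ} {c : ℝ} (hc : 0 < c) (hFc : Continuous F) (hFmono : Monotone F)
    (hFrange : ∀ y, F y ∈ Icc (0:ℝ) 1) (hF₀zero : F₀ 0 = 0)
    (hF₀slope : ∀ p h : ℝ, 0 ≤ p → 0 ≤ h → c * h ≤ F₀ (p + h) - F₀ p)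
    (ω : Measure ℝ) (hω : IsFiniteMeasure ω) (Pbar D R : ℝ) :
    price F F₀ Pbar D R ω
      = min (sInf {p : ℝ | 0 ≤ p ∧ max (D - R) 0 ≤ (∫ x, F (p - x) ∂ω) + F₀ p}) Pbar := by
  have : (priceSet F F₀ D R ω).Nonempty :=
    inf_nonempty (h := fun p => (∫ x, F (p - x) ∂ω) + F₀ p) hc (le_max_right _ _)
      (supply_mono hFc hFmono hFrange hF₀slope ω hω) (supply_zero hFrange hF₀zero ω)
  rw [price, if_pos this]
  rfl

lemma price_mem {F F₀ : ℝ → ℝ} {Pbar D R : ℝ} (hP : 0 ≤ Pbar) (ω : Measure ℝ) :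
    price F F₀ Pbar D R ω ∈ Icc 0 Pbar := by
  rw [price]
  split_ifs with h
  · exact ⟨le_min (le_csInf h fun p hp => hp.1) hP, min_le_right _ _⟩
  · exact ⟨hP, le_rfl⟩

lemma price_meas {F F₀ : ℝ → ℝ} {c T : ℝ} (hc : 0 < c) (hFc : Continuous F) (hFmono : Monotone F)
    (hFrange : ∀ y, F y ∈ Icc (0:ℝ) 1) (hF₀zero : F₀ 0 = 0)
    (hF₀slope : ∀ p h : ℝ, 0 ≤ p → 0 ≤ h → c * h ≤ F₀ (p + h) - F₀ p)
    (Pbar : ℝ) (D : ℝ → ℝ) (hD : AEMeasurable D (volume.restrict (Icc 0 T)))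
    {S S' S'' : Set ℝ} {ηbar η ω : ℝ → Measure ℝ} (h1 : IsMeasFlow T S ηbar)
    (h2 : IsMeasFlow T S' η) (h3 : IsMeasFlow T S'' ω) :
    AEStronglyMeasurable (priceT F F₀ Pbar D ηbar ω η) (volume.restrict (Icc 0 T)) := by
  have m1 := (flow_int_sm h1 (fun x => x) measurable_id).measurable
  have m2 := (flow_int_sm h2 (fun x => x) measurable_id).measurable
  have m3 := inf_meas (c := c) (d := fun t => max (hD.mk D t - Rval (ηbar t) (η t)) 0)
    (h := fun t p => (∫ x, F (p - x) ∂(ω t)) + F₀ p) hc (fun t => le_max_right _ _)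
    (fun t => supply_mono hFc hFmono hFrange hF₀slope (ω t) (h3.1 t))
    (fun t => supply_zero hFrange hF₀zero (ω t))
    ((hD.measurable_mk.sub (m1.sub m2)).max measurable_const)
    (fun q => (flow_int_sm h3 (fun x => F (q - x))
      (Continuous.measurable (by fun_prop))).measurable.add_const _)
  refine ⟨_, (m3.min (measurable_const (a := Pbar))).stronglyMeasurable, ?_⟩
  filter_upwards [hD.ae_eq_mk] with t ht
  rw [priceT, price_eq hc hFc hFmono hFrange hF₀zero hF₀slope (ω t) (h3.1 t), ht]

lemma price_conv {F F₀ : ℝ → ℝ} {c : ℝ} (hc : 0 < c) (hFc : Continuous F) (hFmono : Monotone F)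
    (hFrange : ∀ y, F y ∈ Icc (0:ℝ) 1) (hF₀zero : F₀ 0 = 0)
    (hF₀slope : ∀ p h : ℝ, 0 ≤ p → 0 ≤ h → c * h ≤ F₀ (p + h) - F₀ p)
    (Pbar D : ℝ) (ηbar : Measure ℝ) (η ω : ℕ → Measure ℝ) (η' ω' : Measure ℝ)
    (hω : ∀ n, IsFiniteMeasure (ω n)) (hω' : IsFiniteMeasure ω')
    (hη : Tendsto (fun n => ∫ x, x ∂(η n)) atTop (nhds (∫ x, x ∂η')))
    (hF : ∀ q : ℚ, Tendsto (fun n => ∫ x, F (q - x) ∂(ω n)) atTop (nhds (∫ x, F (q - x) ∂ω'))) :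
    Tendsto (fun n => price F F₀ Pbar D (Rval ηbar (η n)) (ω n)) atTop
      (nhds (price F F₀ Pbar D (Rval ηbar η') ω')) := by
  rw [price_eq hc hFc hFmono hFrange hF₀zero hF₀slope ω' hω']
  simp_rw [fun n => price_eq hc hFc hFmono hFrange hF₀zero hF₀slope (ω n) (hω n) Pbar D
    (Rval ηbar (η n))]
  refine Tendsto.min ?_ tendsto_const_nhds
  refine inf_conv (c := c) (d := max (D - Rval ηbar η') 0)
    (h := fun p => (∫ x, F (p - x) ∂ω') + F₀ p)
    (dn := fun n => max (D - Rval ηbar (η n)) 0)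
    (hn := fun n p => (∫ x, F (p - x) ∂(ω n)) + F₀ p) hc (le_max_right _ _)
    (fun n => le_max_right _ _)
    (supply_mono hFc hFmono hFrange hF₀slope ω' hω') (supply_zero hFrange hF₀zero ω')
    (fun n => supply_mono hFc hFmono hFrange hF₀slope (ω n) (hω n))
    (fun n => supply_zero hFrange hF₀zero (ω n)) ?_ ?_
  · exact ((hη.const_sub _).const_sub _).max tendsto_const_nhds
  · exact fun q => (hF q).add_const _

def clampR (a b x : ℝ) : ℝ := max a (min x b)

lemma clampR_cont (a b : ℝ) : Continuous (clampR a b) := by unfold clampR; fun_prop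

lemma clampR_mem {a b : ℝ} (h : a ≤ b) (x : ℝ) : clampR a b x ∈ Icc a b :=
  ⟨le_max_left _ _, max_le h (min_le_right _ _)⟩

lemma clampR_eq {a b x : ℝ} (h : x ∈ Icc a b) : clampR a b x = x := by
  rw [clampR, min_eq_left h.2, max_eq_right h.1]

lemma clampR_lip (a b x y : ℝ) : |clampR a b x - clampR a b y| ≤ |x - y| := by
  unfold clampR
  rw [max_comm a, max_comm a]
  exact (abs_max_sub_max_le_abs _ _ _).trans (by
    have := abs_min_sub_min_le_max x b y b
    simpa using this)

lemma conv_test {F : ℝ → ℝ} (hFsm : ContDiff ℝ (⊤ : ℕ∞) F)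
    (hFneg : ∀ y ≤ (0:ℝ), F y = 0) (k θ : ℝ) (b : ℝ → ℝ) (hb : Continuous b) (P : ℝ) :
    ∃ f' f'' : ℝ → ℝ, ∃ B : ℝ, 0 ≤ B ∧ (∀ x, HasDerivAt (fun x => F (P - x)) (f' x) x) ∧
      (∀ x, HasDerivAt f' (f'' x) x) ∧ Continuous f'' ∧
      ∀ x ∈ Ici (0:ℝ), |k * (θ - x) * f' x + b x * f'' x| ≤ B := by
  have d1 : ContDiff ℝ (⊤ : ℕ∞) (deriv F) := (contDiff_infty_iff_deriv.1 hFsm).2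
  have d2 : ContDiff ℝ (⊤ : ℕ∞) (deriv (deriv F)) := (contDiff_infty_iff_deriv.1 d1).2
  have df := (contDiff_infty_iff_deriv.1 hFsm).1
  have df1 := (contDiff_infty_iff_deriv.1 d1).1
  have c1 := d1.continuous
  have c2 := d2.continuous
  have e0 : ∀ y < 0, F =ᶠ[nhds y] fun _ => 0 := by
    intro y hy
    filter_upwards [Iio_mem_nhds hy] with z hz using hFneg z (le_of_lt hz)
  have hcont : Continuous fun x => k * (θ - x) * (-deriv F (P - x)) + b x * deriv (deriv F) (P - x) := by
    fun_prop
  obtain ⟨M, hM⟩ := isCompact_Icc.exists_bound_of_continuousOn (s := Icc 0 P) hcont.continuousOn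
  refine ⟨fun x => - deriv F (P - x), fun x => deriv (deriv F) (P - x), max M 0, le_max_right _ _,
    ?_, ?_, by fun_prop, ?_⟩
  · intro x
    have := (df (P - x)).hasDerivAt.comp x ((hasDerivAt_id x).const_sub P)
    simpa [Function.comp_def] using this
  · intro x
    have := ((df1 (P - x)).hasDerivAt.comp x ((hasDerivAt_id x).const_sub P)).fun_neg
    simpa [Function.comp_def] using this
  · intro x hx
    rcases le_or_gt x P with h | h
    · exact (hM x ⟨hx, h⟩).trans (le_max_left _ _)
    · have hy : P - x < 0 := by linarith
      have e1 := (e0 _ hy).deriv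
      have a1 : deriv F (P - x) = 0 := by simpa using (e0 _ hy).deriv_eq
      have a2 : deriv (deriv F) (P - x) = 0 := by simpa using e1.deriv_eq
      simp only [a1, a2]
      simp

lemma gainC_conv {T ρ Pbar M : ℝ} (hT : 0 < T) (hρ : 0 < ρ) (hPbar : 0 < Pbar)
    {F G fC : ℝ → ℝ} (hFc : Continuous F)
    (hFrange : ∀ y, F y ∈ Icc (0:ℝ) 1) (hFneg : ∀ y ≤ (0:ℝ), F y = 0)
    (hG : ∀ x, G x = ∫ z in (0:ℝ)..x, F z) (hfC : Continuous fC)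
    {m : ℕ → ℝ → Measure ℝ} {m' : ℝ → Measure ℝ}
    (h : ∀ n, IsMeasFlow T (Ici 0) (m n)) (h' : IsMeasFlow T (Ici 0) m') (hM0 : 0 ≤ M)
    (hM : ∀ n, ∀ᵐ t ∂(volume.restrict (Icc 0 T)), (m n t).real univ ≤ M)
    (hM' : ∀ᵐ t ∂(volume.restrict (Icc 0 T)), (m' t).real univ ≤ M)
    (hw : WeakConvFlow T m m')
    (P : ℕ → ℝ → ℝ) (P' : ℝ → ℝ)
    (hPm : ∀ n, AEStronglyMeasurable (P n) (volume.restrict (Icc 0 T)))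
    (hPm' : AEStronglyMeasurable P' (volume.restrict (Icc 0 T)))
    (hPb : ∀ n t, P n t ∈ Icc 0 Pbar) (hPb' : ∀ t, P' t ∈ Icc 0 Pbar)
    (hP : ∀ᵐ t ∂(volume.restrict (Icc 0 T)), Tendsto (fun n => P n t) atTop (nhds (P' t))) :
    Tendsto (fun n => ∫ t in Icc 0 T, Real.exp (-ρ * t) * ∫ x, (G (P n t - x) + fC t) ∂(m n t)) atTop
      (nhds (∫ t in Icc 0 T, Real.exp (-ρ * t) * ∫ x, (G (P' t - x) + fC t) ∂(m' t))) := by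
  have Glip : ∀ x y, |G x - G y| ≤ |x - y| := by
    intro x y
    rw [hG, hG, intervalIntegral.integral_interval_sub_left (hFc.intervalIntegrable _ _)
      (hFc.intervalIntegrable _ _)]
    have := intervalIntegral.norm_integral_le_of_norm_le_const (a := y) (b := x) (f := F) (C := 1)
      (fun z _ => by rw [Real.norm_eq_abs, abs_of_nonneg (hFrange z).1]; exact (hFrange z).2)
    simpa using this
  have Gc : Continuous G := by
    have : G = fun x => ∫ z in (0:ℝ)..x, F z := funext hG
    rw [this]
    exact intervalIntegral.continuous_primitive (fun a b => hFc.intervalIntegrable _ _) 0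
  have G0 : G 0 = 0 := by rw [hG]; simp
  have Gneg : ∀ x ≤ 0, G x = 0 := by
    intro x hx
    rw [hG, intervalIntegral.integral_symm, intervalIntegral.integral_of_le hx,
      setIntegral_congr_fun (g := fun _ => (0:ℝ)) measurableSet_Ioc (fun z hz => hFneg z hz.2)]
    simp
  obtain ⟨Q, hQ⟩ := isCompact_Icc.exists_bound_of_continuousOn (s := Icc 0 T) hfC.continuousOn
  have hQ0 : 0 ≤ Q := (norm_nonneg _).trans (hQ 0 ⟨le_rfl, hT.le⟩)
  let Ψ : ℝ → ℝ → ℝ → ℝ := fun p t x => Real.exp (-ρ * clampR 0 T t) *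
    (G (clampR 0 Pbar p - max x 0) + fC (clampR 0 T t))
  have cc := clampR_cont
  have hE : ∀ t, |Real.exp (-ρ * clampR 0 T t)| ≤ 1 := by
    intro t
    rw [Real.abs_exp, Real.exp_le_one_iff]
    nlinarith [(clampR_mem hT.le t).1]
  have main := gain_conv (Q := Pbar + Q) (L := 1) (Bp := Pbar) h h' hM0 hM hM' hw zero_le_one
    (by positivity) Ψ
    (by
      have := cc 0 T
      have := cc 0 Pbar
      fun_prop) ?_ ?_ P P' hPm hPm' ?_ ?_ hP
  · have e : ∀ (q : ℝ → Measure ℝ) (p : ℝ → ℝ), IsMeasFlow T (Ici 0) q → (∀ t, p t ∈ Icc 0 Pbar) →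
        ∫ t in Icc 0 T, ∫ x, Ψ (p t) t x ∂(q t)
          = ∫ t in Icc 0 T, Real.exp (-ρ * t) * ∫ x, (G (p t - x) + fC t) ∂(q t) := by
      intro q p hq hp
      refine setIntegral_congr_fun measurableSet_Icc fun t ht => ?_
      rw [← integral_const_mul]
      refine integral_congr_ae ?_
      filter_upwards [flow_mem hq t] with x hx
      simp only [Ψ]
      rw [clampR_eq ht, clampR_eq (hp t), max_eq_left hx]
    rw [e m' P' h' hPb'] at main
    simpa only [fun n => e (m n) (P n) (h n) (hPb n)] using main
  · intro p t x
    simp only [Ψ]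
    rw [abs_mul]
    have a1 : |G (clampR 0 Pbar p - max x 0)| ≤ Pbar := by
      rcases le_or_gt (clampR 0 Pbar p - max x 0) 0 with hz | hz
      · rw [Gneg _ hz]; simpa using hPbar.le
      · have := Glip (clampR 0 Pbar p - max x 0) 0
        rw [G0, sub_zero, sub_zero, abs_of_pos hz] at this
        linarith [(clampR_mem hPbar.le p).2, le_max_right x 0]
    have a2 := hQ _ (clampR_mem hT.le t)
    rw [Real.norm_eq_abs] at a2
    have a3 : |G (clampR 0 Pbar p - max x 0) + fC (clampR 0 T t)| ≤ Pbar + Q :=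
      (abs_add_le _ _).trans (add_le_add a1 a2)
    calc _ ≤ 1 * (Pbar + Q) := mul_le_mul (hE t) a3 (abs_nonneg _) zero_le_one
      _ = _ := one_mul _
  · intro p q t x
    simp only [Ψ]
    rw [← mul_sub, abs_mul, add_sub_add_right_eq_sub]
    refine mul_le_mul (hE t) ?_ (abs_nonneg _) zero_le_one
    refine (Glip _ _).trans ?_
    rw [sub_sub_sub_cancel_right]
    exact clampR_lip _ _ _ _
  · intro n t
    rw [abs_of_nonneg (hPb n t).1]; exact (hPb n t).2
  · intro t
    rw [abs_of_nonneg (hPb' t).1]; exact (hPb' t).2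

lemma gainR_conv {T ρ Pbar M : ℝ} (hT : 0 < T) (hρ : 0 < ρ) (hPbar : 0 < Pbar)
    {fR : ℝ → ℝ} (hfR : Continuous fR)
    {m : ℕ → ℝ → Measure ℝ} {m' : ℝ → Measure ℝ}
    (h : ∀ n, IsMeasFlow T (Icc 0 1) (m n)) (h' : IsMeasFlow T (Icc 0 1) m') (hM0 : 0 ≤ M)
    (hM : ∀ n, ∀ᵐ t ∂(volume.restrict (Icc 0 T)), (m n t).real univ ≤ M)
    (hM' : ∀ᵐ t ∂(volume.restrict (Icc 0 T)), (m' t).real univ ≤ M)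
    (hw : WeakConvFlow T m m')
    (P : ℕ → ℝ → ℝ) (P' : ℝ → ℝ)
    (hPm : ∀ n, AEStronglyMeasurable (P n) (volume.restrict (Icc 0 T)))
    (hPm' : AEStronglyMeasurable P' (volume.restrict (Icc 0 T)))
    (hPb : ∀ n t, P n t ∈ Icc 0 Pbar) (hPb' : ∀ t, P' t ∈ Icc 0 Pbar)
    (hP : ∀ᵐ t ∂(volume.restrict (Icc 0 T)), Tendsto (fun n => P n t) atTop (nhds (P' t))) :
    Tendsto (fun n => ∫ t in Icc 0 T, Real.exp (-ρ * t) * ∫ x, (-(P n t) * x + fR t) ∂(m n t)) atTop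
      (nhds (∫ t in Icc 0 T, Real.exp (-ρ * t) * ∫ x, (-(P' t) * x + fR t) ∂(m' t))) := by
  obtain ⟨Q, hQ⟩ := isCompact_Icc.exists_bound_of_continuousOn (s := Icc 0 T) hfR.continuousOn
  have hQ0 : 0 ≤ Q := (norm_nonneg _).trans (hQ 0 ⟨le_rfl, hT.le⟩)
  let Ψ : ℝ → ℝ → ℝ → ℝ := fun p t x => Real.exp (-ρ * clampR 0 T t) *
    (-(clampR 0 Pbar p) * clampR 0 1 x + fR (clampR 0 T t))
  have cc := clampR_cont
  have hE : ∀ t, |Real.exp (-ρ * clampR 0 T t)| ≤ 1 := by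
    intro t
    rw [Real.abs_exp, Real.exp_le_one_iff]
    nlinarith [(clampR_mem hT.le t).1]
  have hx1 : ∀ x, |clampR 0 1 x| ≤ 1 := by
    intro x
    have := clampR_mem (zero_le_one (α := ℝ)) x
    rw [abs_of_nonneg this.1]; exact this.2
  have main := gain_conv (Q := Pbar + Q) (L := 1) (Bp := Pbar) h h' hM0 hM hM' hw zero_le_one
    (by positivity) Ψ
    (by
      have := cc 0 T
      have := cc 0 Pbar
      have := cc 0 1
      fun_prop) ?_ ?_ P P' hPm hPm' ?_ ?_ hP
  · have e : ∀ (q : ℝ → Measure ℝ) (p : ℝ → ℝ), IsMeasFlow T (Icc 0 1) q → (∀ t, p t ∈ Icc 0 Pbar) →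
        ∫ t in Icc 0 T, ∫ x, Ψ (p t) t x ∂(q t)
          = ∫ t in Icc 0 T, Real.exp (-ρ * t) * ∫ x, (-(p t) * x + fR t) ∂(q t) := by
      intro q p hq hp
      refine setIntegral_congr_fun measurableSet_Icc fun t ht => ?_
      rw [← integral_const_mul]
      refine integral_congr_ae ?_
      filter_upwards [flow_mem hq t] with x hx
      simp only [Ψ]
      rw [clampR_eq ht, clampR_eq (hp t), clampR_eq hx]
    rw [e m' P' h' hPb'] at main
    simpa only [fun n => e (m n) (P n) (h n) (hPb n)] using main
  · intro p t x
    simp only [Ψ]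
    rw [abs_mul]
    have a1 : |-(clampR 0 Pbar p) * clampR 0 1 x| ≤ Pbar := by
      have := clampR_mem hPbar.le p
      rw [abs_mul, abs_neg, abs_of_nonneg this.1]
      calc _ ≤ Pbar * 1 := mul_le_mul this.2 (hx1 x) (abs_nonneg _) hPbar.le
        _ = _ := mul_one _
    have a2 := hQ _ (clampR_mem hT.le t)
    rw [Real.norm_eq_abs] at a2
    have a3 : |-(clampR 0 Pbar p) * clampR 0 1 x + fR (clampR 0 T t)| ≤ Pbar + Q :=
      (abs_add_le _ _).trans (add_le_add a1 a2)
    calc _ ≤ 1 * (Pbar + Q) := mul_le_mul (hE t) a3 (abs_nonneg _) zero_le_one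
      _ = _ := one_mul _
  · intro p q t x
    simp only [Ψ]
    rw [← mul_sub, abs_mul, add_sub_add_right_eq_sub]
    refine mul_le_mul (hE t) ?_ (abs_nonneg _) zero_le_one
    rw [← sub_mul, abs_mul, neg_sub_neg, abs_sub_comm]
    calc _ ≤ |p - q| * 1 := mul_le_mul (clampR_lip _ _ _ _) (hx1 x) (abs_nonneg _) (abs_nonneg _)
      _ = _ := mul_one _
  · intro n t
    rw [abs_of_nonneg (hPb n t).1]; exact (hPb n t).2
  · intro t
    rw [abs_of_nonneg (hPb' t).1]; exact (hPb' t).2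

/-- joint continuity of the gain functionals along weakly converging
sequences of flows (closed-graph property): along a subsequence, both the conventional
and the renewable gains converge to the gains of the limiting flows. -/
theorem gains_converge_along_subsequence
    (T k θ δ : ℝ) (hT : 0 < T) (hk : 0 < k) (hθ : 0 < θ) (hδ : 0 < δ)
    (kb θb δb : ℝ) (hkb : 0 < kb) (hθb : θb ∈ Ioo (0:ℝ) 1) (hδb : 0 < δb)
    (F : ℝ → ℝ) (c₁ : ℝ) (hc₁ : 0 < c₁) (hFsm : ContDiff ℝ (⊤ : ℕ∞) F) (hFmono : Monotone F)
    (hFrange : ∀ y, F y ∈ Icc (0:ℝ) 1) (hFneg : ∀ y ≤ (0:ℝ), F y = 0)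
    (hFpos : ∀ y > (0:ℝ), 0 < F y) (hFone : ∀ y ≥ c₁, F y = 1)
    (F₀ : ℝ → ℝ) (c : ℝ) (hc : 0 < c) (hF₀zero : F₀ 0 = 0)
    (hF₀mono : MonotoneOn F₀ (Ici 0))
    (hF₀slope : ∀ p h : ℝ, 0 ≤ p → 0 ≤ h → c * h ≤ F₀ (p + h) - F₀ p)
    (Pbar : ℝ) (hPbar : 0 < Pbar)
    (ηbar₀ : Measure ℝ) (hηbar₀fin : IsFiniteMeasure ηbar₀)
    (hηbar₀supp : ηbar₀ (Icc (0:ℝ) 1)ᶜ = 0)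
    (ηbar : ℝ → Measure ℝ) (hηbar : AdmR T kb θb δb ηbar₀ ηbar)
    (D : ℝ → ℝ) (hD : BoundedVariationOn D (Icc 0 T))
    (ω₀ : Measure ℝ) (hω₀fin : IsFiniteMeasure ω₀) (hω₀supp : ω₀ (Ici (0:ℝ))ᶜ = 0)
    (η₀ : Measure ℝ) (hη₀fin : IsFiniteMeasure η₀) (hη₀supp : η₀ (Icc (0:ℝ) 1)ᶜ = 0)
    (ρ κC KC γC : ℝ) (hρ : 0 < ρ) (hκC : 0 ≤ κC) (hKC : 0 ≤ KC) (hγC : 0 ≤ γC)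
    (G fC : ℝ → ℝ) (hG : ∀ x, G x = ∫ z in (0:ℝ)..x, F z)
    (hfC : ∀ t, fC t = -κC - Real.exp (-γC * t) * KC * (ρ + γC))
    (κR KR γR : ℝ) (hκR : 0 ≤ κR) (hKR : 0 ≤ KR) (hγR : 0 ≤ γR)
    (fR : ℝ → ℝ)
    (hfR : ∀ t, fR t = κR + ρ * KR + γR * KR * Real.exp (-(ρ + γR) * (T - t)))
    (ωseq ωhatseq : ℕ → ℝ → Measure ℝ)
    (hωseq : ∀ n, AdmC T k θ δ ω₀ (ωseq n)) (hωhatseq : ∀ n, AdmC T k θ δ ω₀ (ωhatseq n))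
    (ω ωhat : ℝ → Measure ℝ) (hω : AdmC T k θ δ ω₀ ω) (hωhat : AdmC T k θ δ ω₀ ωhat)
    (hωconv : WeakConvFlow T ωseq ω) (hωhatconv : WeakConvFlow T ωhatseq ωhat)
    (ηseq ηhatseq : ℕ → ℝ → Measure ℝ)
    (hηseq : ∀ n, AdmR T kb θb δb η₀ (ηseq n)) (hηhatseq : ∀ n, AdmR T kb θb δb η₀ (ηhatseq n))
    (η ηhat : ℝ → Measure ℝ) (hη : AdmR T kb θb δb η₀ η) (hηhat : AdmR T kb θb δb η₀ ηhat)
    (hηconv : WeakConvFlow T ηseq η) (hηhatconv : WeakConvFlow T ηhatseq ηhat) :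
    ∃ φ : ℕ → ℕ, StrictMono φ ∧
      Tendsto (fun q => ∫ t in Icc (0:ℝ) T, Real.exp (-ρ * t) *
          ∫ x, (G (priceT F F₀ Pbar D ηbar (ωseq (φ q)) (ηseq (φ q)) t - x) + fC t)
            ∂(ωhatseq (φ q) t))
        atTop (nhds (∫ t in Icc (0:ℝ) T, Real.exp (-ρ * t) *
          ∫ x, (G (priceT F F₀ Pbar D ηbar ω η t - x) + fC t) ∂(ωhat t))) ∧
      Tendsto (fun q => ∫ t in Icc (0:ℝ) T, Real.exp (-ρ * t) *
          ∫ x, (-(priceT F F₀ Pbar D ηbar (ωseq (φ q)) (ηseq (φ q)) t) * x + fR t)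
            ∂(ηhatseq (φ q) t))
        atTop (nhds (∫ t in Icc (0:ℝ) T, Real.exp (-ρ * t) *
          ∫ x, (-(priceT F F₀ Pbar D ηbar ω η t) * x + fR t) ∂(ηhat t))) := by
  have hFc : Continuous F := hFsm.continuous
  have hDm : AEMeasurable D (volume.restrict (Icc 0 T)) := by
    obtain ⟨p, q, hp, hq, e⟩ :=
      hD.locallyBoundedVariationOn.exists_monotoneOn_sub_monotoneOn
    rw [e]
    exact (aemeasurable_restrict_of_monotoneOn measurableSet_Icc hp).sub
      (aemeasurable_restrict_of_monotoneOn measurableSet_Icc hq)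
  have hfCc : Continuous fC := by
    rw [funext hfC]; fun_prop
  have hfRc : Continuous fR := by
    rw [funext hfR]; fun_prop
  have hb : Continuous fun x : ℝ => δ ^ 2 * x / 2 := by fun_prop
  have hbb : Continuous fun x : ℝ => δb ^ 2 * x * (1 - x) / 2 := by fun_prop
  have cω : ∀ᵐ t ∂(volume.restrict (Icc 0 T)), ∀ q : ℚ,
      Tendsto (fun n => ∫ x, F (q - x) ∂(ωseq n t)) atTop (nhds (∫ x, F (q - x) ∂(ω t))) := by
    refine ae_all_iff.2 fun q => ?_
    obtain ⟨f', f'', B, hB0, hf, hf', hf'', hB⟩ := conv_test hFsm hFneg k θ _ hb (q:ℝ)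
    have hbd : ∀ x, |F ((q:ℝ) - x)| ≤ 1 := fun x => by
      rw [abs_of_nonneg (hFrange _).1]; exact (hFrange _).2
    exact flow_conv hT hω₀fin hω₀supp hb.measurable hωseq hω hωconv (fun x => F ((q:ℝ) - x)) f' f''
      (fun x => F ((q:ℝ) - x)) 1 B zero_le_one hB0 hf hf' hf'' (fun x _ => (hFrange _).1)
      (fun x _ => hbd x) hB (by fun_prop) hbd (fun _ _ => rfl)
  have cη : ∀ᵐ t ∂(volume.restrict (Icc 0 T)),
      Tendsto (fun n => ∫ x, x ∂(ηseq n t)) atTop (nhds (∫ x, x ∂(η t))) := by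
    refine flow_conv hT hη₀fin hη₀supp hbb.measurable hηseq hη hηconv (fun x => x)
      (fun _ => 1) (fun _ => 0) (clampR 0 1) 1 kb zero_le_one hkb.le (fun x => hasDerivAt_id x)
      (fun x => hasDerivAt_const _ _) continuous_const (fun x hx => hx.1)
      (fun x hx => by rw [abs_of_nonneg hx.1]; exact hx.2) ?_ (clampR_cont 0 1) ?_
      (fun x hx => (clampR_eq hx).symm)
    · intro x hx
      rw [mul_zero, add_zero, mul_one, abs_mul, abs_of_pos hkb]
      have : |θb - x| ≤ 1 := abs_le.2 ⟨by linarith [hθb.1, hx.2], by linarith [hθb.2, hx.1]⟩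
      nlinarith
    · intro x
      have := clampR_mem (zero_le_one (α := ℝ)) x
      rw [abs_of_nonneg this.1]; exact this.2
  have cP : ∀ᵐ t ∂(volume.restrict (Icc 0 T)),
      Tendsto (fun n => priceT F F₀ Pbar D ηbar (ωseq n) (ηseq n) t) atTop
        (nhds (priceT F F₀ Pbar D ηbar ω η t)) := by
    filter_upwards [cω, cη] with t h1 h2
    exact price_conv hc hFc hFmono hFrange hF₀zero hF₀slope Pbar (D t) (ηbar t)
      (fun n => ηseq n t) (fun n => ωseq n t) (η t) (ω t) (fun n => (hωseq n).1.1 t) (hω.1.1 t) h2 h1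
  have mP : ∀ n, AEStronglyMeasurable (priceT F F₀ Pbar D ηbar (ωseq n) (ηseq n))
      (volume.restrict (Icc 0 T)) := fun n =>
    price_meas hc hFc hFmono hFrange hF₀zero hF₀slope Pbar D hDm hηbar.1 (hηseq n).1 (hωseq n).1
  have mP' : AEStronglyMeasurable (priceT F F₀ Pbar D ηbar ω η)
      (volume.restrict (Icc 0 T)) :=
    price_meas hc hFc hFmono hFrange hF₀zero hF₀slope Pbar D hDm hηbar.1 hη.1 hω.1
  refine ⟨id, strictMono_id, ?_, ?_⟩
  · exact gainC_conv hT hρ hPbar hFc hFrange hFneg hG hfCc (fun n => (hωhatseq n).1) hωhat.1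
      (measureReal_nonneg (μ := ω₀) (s := univ)) (fun n => mass_bound hT hω₀fin (hωhatseq n))
      (mass_bound hT hω₀fin hωhat) hωhatconv _ _ mP mP' (fun n t => price_mem hPbar.le _)
      (fun t => price_mem hPbar.le _) cP
  · exact gainR_conv hT hρ hPbar hfRc (fun n => (hηhatseq n).1) hηhat.1
      (measureReal_nonneg (μ := η₀) (s := univ)) (fun n => mass_bound hT hη₀fin (hηhatseq n))
      (mass_bound hT hη₀fin hηhat) hηhatconv _ _ mP mP' (fun n t => price_mem hPbar.le _)
      (fun t => price_mem hPbar.le _) cP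

end
end

section
/- Let (ωⁿ) be a sequence in A(ω₀) converging weakly to ω ∈ A(ω₀). Then there exists a subsequence (n_q) such that the total-mass functions t ↦ ω^{n_q}_t(Ω) converge in L¹([0,T]) to the function t ↦ ω_t(Ω). -/
open MeasureTheory Set Filter
open scoped Classical

noncomputable section

lemma tm_approx (μ : Measure ℝ) [IsFiniteMeasure μ] (g : ℝ → ℝ) (hg : Measurable g)
    (hg0 : ∀ t, 0 ≤ g t) (hgi : Integrable g μ) (h : ℝ → ℝ) (hh : Measurable h)
    (M : ℝ) (hM : ∀ t, |h t| ≤ M) (e : ℝ) (he : 0 < e) :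
    ∃ h' : ℝ → ℝ, Continuous h' ∧ (∃ M', ∀ t, |h' t| ≤ M') ∧
      ∫ t, |h t - h' t| * (1 + g t) ∂μ ≤ e := by
  set d : ℝ → NNReal := fun t => (1 + g t).toNNReal with hd
  have hdm : Measurable d := by fun_prop
  have hi1 : Integrable (fun t => 1 + g t) μ := (integrable_const 1).add hgi
  have : IsFiniteMeasure (μ.withDensity (fun t => (d t : ENNReal))) := by
    apply isFiniteMeasure_withDensity
    exact hi1.lintegral_lt_top.ne
  have hhi : Integrable h (μ.withDensity (fun t => (d t : ENNReal))) :=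
    Integrable.of_bound hh.aestronglyMeasurable M (by filter_upwards with t using hM t)
  obtain ⟨h', h1, -⟩ := hhi.exists_boundedContinuous_integral_sub_le he
  refine ⟨h', h'.continuous, ⟨‖h'‖, fun t => h'.norm_coe_le_norm t⟩, ?_⟩
  rw [integral_withDensity_eq_integral_smul hdm] at h1
  refine le_trans (le_of_eq (integral_congr_ae ?_)) h1
  filter_upwards with t
  have : (0:ℝ) ≤ 1 + g t := by linarith [hg0 t]
  simp [hd, NNReal.smul_def, Real.coe_toNNReal _ this, mul_comm]

def TMProp (T c : ℝ) (g : ℝ → ℝ) : Prop :=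
  ∀ f f' : ℝ → ℝ, Continuous f' → (∀ t, HasDerivAt f (f' t) t) →
    (∀ t ∈ Icc 0 T, 0 ≤ f t) → 0 ≤ c * f 0 + ∫ t in Icc 0 T, f' t * g t

lemma tm_key (T c : ℝ) (hc : 0 ≤ c) (g : ℝ → ℝ) (hg : Measurable g)
    (hg0 : ∀ t, 0 ≤ g t) (hgi : IntegrableOn g (Icc 0 T)) (hP : TMProp T c g)
    (h : ℝ → ℝ) (hh : Measurable h) (M : ℝ) (hM : ∀ t, |h t| ≤ M) (f0 : ℝ)
    (hf0 : ∀ t ∈ Icc 0 T, 0 ≤ f0 + ∫ s in (0:ℝ)..t, h s) :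
    0 ≤ c * f0 + ∫ t in Icc 0 T, h t * g t := by
  apply le_of_forall_pos_le_add
  intro e he
  have hpos : 0 < e / (c + 1) := by positivity
  obtain ⟨h', hc', ⟨M', hM'⟩, hle⟩ := tm_approx (volume.restrict (Icc 0 T)) g hg hg0 hgi h hh M hM _ hpos
  set e' := e / (c+1)
  have hee : e' * (c+1) = e := by simp only [e']; field_simp
  have hdm : Measurable (fun t => h t - h' t) := hh.sub hc'.measurable
  have hdi : Integrable (fun t => h t - h' t) (volume.restrict (Icc 0 T)) :=
    Integrable.of_bound hdm.aestronglyMeasurable (M + M') (by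
      filter_upwards with t
      exact (norm_sub_le _ _).trans (add_le_add (hM t) (hM' t)))
  have hdg : Integrable (fun t => (h t - h' t) * g t) (volume.restrict (Icc 0 T)) :=
    Integrable.bdd_mul (c := M + M') hgi hdm.aestronglyMeasurable (by
      filter_upwards with t
      exact (norm_sub_le _ _).trans (add_le_add (hM t) (hM' t)))
  have hh'g : Integrable (fun t => h' t * g t) (volume.restrict (Icc 0 T)) :=
    Integrable.bdd_mul (c := M') hgi hc'.measurable.aestronglyMeasurable (by
      filter_upwards with t using hM' t)
  have hsplit : ∫ t in Icc 0 T, |h t - h' t| * (1 + g t)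
      = (∫ t in Icc 0 T, |h t - h' t|) + ∫ t in Icc 0 T, |(h t - h' t) * g t| := by
    rw [← integral_add hdi.abs hdg.abs]
    congr 1; ext t
    rw [abs_mul, abs_of_nonneg (hg0 t)]; ring
  have hA : 0 ≤ ∫ t in Icc 0 T, |h t - h' t| := integral_nonneg fun t => abs_nonneg _
  have hB : 0 ≤ ∫ t in Icc 0 T, |(h t - h' t) * g t| := integral_nonneg fun t => abs_nonneg _
  have hP' := hP (fun t => f0 + e' - (∫ t in Icc 0 T, |(h t - h' t) * g t|) + ∫ s in (0:ℝ)..t, h' s) h' hc'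
    (fun t => by
      have := (intervalIntegral.integral_hasDerivAt_right (hc'.intervalIntegrable 0 t)
        (hc'.stronglyMeasurableAtFilter _ _) hc'.continuousAt)
      exact this.const_add _) (fun t ht => by
      have h1 := hf0 t ht
      have h2 : (∫ s in (0:ℝ)..t, h s) - ∫ s in (0:ℝ)..t, h' s ≤ ∫ t in Icc 0 T, |h t - h' t| := by
        have hii : IntervalIntegrable (fun t => h t - h' t) volume 0 t := by
          rw [intervalIntegrable_iff_integrableOn_Ioc_of_le ht.1]
          exact hdi.mono_measure (Measure.restrict_mono (show Ioc 0 t ⊆ Icc 0 T from fun s hs => ⟨hs.1.le, hs.2.trans ht.2⟩) le_rfl)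
        have hi' := hc'.intervalIntegrable (μ := volume) 0 t
        have hih : IntervalIntegrable h volume 0 t := by
          simpa using hii.add hi'
        rw [← intervalIntegral.integral_sub hih hi', intervalIntegral.integral_of_le ht.1]
        refine (integral_mono hii.1 hii.1.abs fun s => le_abs_self _).trans ?_
        apply setIntegral_mono_set hdi.abs (by filter_upwards with s using abs_nonneg _)
        exact (show Ioc 0 t ⊆ Icc 0 T from fun s hs => ⟨hs.1.le, hs.2.trans ht.2⟩).eventuallyLE
      show 0 ≤ f0 + e' - _ + _
      linarith)
  simp only [intervalIntegral.integral_same, add_zero] at hP'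
  have h3 : (∫ t in Icc 0 T, h' t * g t) ≤ (∫ t in Icc 0 T, h t * g t) + ∫ t in Icc 0 T, |(h t - h' t) * g t| := by
    have : (∫ t in Icc 0 T, h t * g t) = (∫ t in Icc 0 T, h' t * g t) + ∫ t in Icc 0 T, (h t - h' t) * g t := by
      rw [← integral_add hh'g hdg]
      congr 1; ext t; ring
    have h4 := neg_abs_le (∫ t in Icc 0 T, (h t - h' t) * g t)
    have h5 := abs_integral_le_integral_abs (f := fun t => (h t - h' t) * g t) (μ := volume.restrict (Icc 0 T))
    linarith
  have h6 := mul_nonneg hc hB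
  nlinarith

lemma tm_bound (T c : ℝ) (hc : 0 ≤ c) (g : ℝ → ℝ) (hg : Measurable g)
    (hg0 : ∀ t, 0 ≤ g t) (hgi : IntegrableOn g (Icc 0 T)) (hP : TMProp T c g) :
    ∀ᵐ t ∂(volume.restrict (Icc 0 T)), g t ≤ c := by
  apply ae_le_of_forall_setIntegral_le hgi (integrable_const c)
  intro s hs _
  have := tm_key T c hc g hg hg0 hgi hP (s.indicator fun _ => -1)
    (measurable_const.indicator hs) 1
    (fun t => by by_cases h : t ∈ s <;> simp [h]) ((volume.restrict (Icc 0 T)).real s) (by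
      intro t ht
      rw [intervalIntegral.integral_of_le ht.1, integral_indicator hs]
      simp only [integral_const, measureReal_restrict_apply_univ, smul_eq_mul]
      have : (volume.restrict (Ioc 0 t)).real s ≤ (volume.restrict (Icc 0 T)).real s := by
        simp only [measureReal_def]
        apply ENNReal.toReal_mono (measure_ne_top _ _)
        exact Measure.restrict_mono (show Ioc 0 t ⊆ Icc 0 T from fun s hs => ⟨hs.1.le, hs.2.trans ht.2⟩) le_rfl s
      linarith)
  have h2 : ∫ t in Icc 0 T, s.indicator (fun _ => (-1:ℝ)) t * g t
      = - ∫ t in s, g t ∂(volume.restrict (Icc 0 T)) := by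
    rw [← integral_indicator hs, ← integral_neg]
    congr 1; ext t
    by_cases h : t ∈ s <;> simp [h]
  rw [h2] at this
  simp only [integral_const, measureReal_restrict_apply_univ, smul_eq_mul]
  linarith

lemma tm_concave (T c : ℝ) (hc : 0 ≤ c) (g : ℝ → ℝ) (hg : Measurable g)
    (hg0 : ∀ t, 0 ≤ g t) (hgi : IntegrableOn g (Icc 0 T)) (hP : TMProp T c g) :
    ConcaveOn ℝ (Icc 0 T) (fun t => ∫ s in (0:ℝ)..t, g s) := by
  apply concaveOn_of_slope_anti_adjacent (convex_Icc 0 T)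
  intro x y z hx hz hxy hyz
  have hxy' : 0 < y - x := by linarith
  have hyz' : 0 < z - y := by linarith
  have hgI : ∀ a b, 0 ≤ a → a ≤ b → b ≤ T → IntervalIntegrable g volume a b := by
    intro a b ha hab hb
    rw [intervalIntegrable_iff_integrableOn_Ioc_of_le hab]
    exact hgi.mono_set (fun s hs => ⟨ha.trans hs.1.le, hs.2.trans hb⟩)
  have hv : ∀ a b t, 0 ≤ a → 0 ≤ t → a ≤ b → ∫ s in (0:ℝ)..t, (Ioc a b).indicator (fun _ => (1:ℝ)) s
      = max (min t b - a) 0 := by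
    intro a b t ha ht hab
    rw [intervalIntegral.integral_of_le ht, integral_indicator measurableSet_Ioc,
      Measure.restrict_restrict measurableSet_Ioc, Ioc_inter_Ioc]
    simp only [integral_const, measureReal_restrict_apply_univ, smul_eq_mul, mul_one]
    rw [max_eq_left ha, Measure.real, Real.volume_Ioc, ENNReal.toReal_ofReal', min_comm]
  have hii : ∀ a b t, IntervalIntegrable ((Ioc a b).indicator (fun _ => (1:ℝ))) volume 0 t := by
    intro a b t
    exact (IntegrableOn.integrable_indicator (by simp) measurableSet_Ioc).intervalIntegrable
  have := tm_key T c hc g hg hg0 hgi hP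
    (fun s => (y-x)⁻¹ * (Ioc x y).indicator (fun _ => 1) s - (z-y)⁻¹ * (Ioc y z).indicator (fun _ => 1) s)
    (((measurable_const.indicator measurableSet_Ioc).const_mul _).sub
      ((measurable_const.indicator measurableSet_Ioc).const_mul _)) ((y-x)⁻¹ + (z-y)⁻¹)
    (fun t => by
      have : 0 < (y-x)⁻¹ := by positivity
      have : 0 < (z-y)⁻¹ := by positivity
      simp only [indicator]
      split_ifs <;> rw [abs_le] <;> constructor <;> linarith) 0 (by
    intro t ht
    rw [intervalIntegral.integral_sub ((hii _ _ _).const_mul _) ((hii _ _ _).const_mul _),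
      intervalIntegral.integral_const_mul, intervalIntegral.integral_const_mul,
      hv _ _ _ hx.1 ht.1 hxy.le, hv _ _ _ (hx.1.trans hxy.le) ht.1 hyz.le]
    rcases le_total t y with h | h
    · rw [max_eq_right (a := min t z - y) (by linarith [min_le_left t z])]
      have : 0 ≤ max (min t y - x) 0 := le_max_right _ _
      simp only [mul_zero, sub_zero, zero_add]
      positivity
    · rw [min_eq_right h, max_eq_left hxy'.le, inv_mul_cancel₀ hxy'.ne']
      have : max (min t z - y) 0 ≤ z - y := max_le (by linarith [min_le_right t z]) hyz'.le
      have h3 : (z-y)⁻¹ * max (min t z - y) 0 ≤ (z-y)⁻¹ * (z-y) := by gcongr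
      rw [inv_mul_cancel₀ hyz'.ne'] at h3
      linarith)
  have hgv : ∀ a b, 0 ≤ a → a ≤ b → b ≤ T →
      (Integrable (fun s => (Ioc a b).indicator (fun _ => (1:ℝ)) s * g s) (volume.restrict (Icc 0 T))) ∧
      ∫ s in Icc 0 T, (Ioc a b).indicator (fun _ => (1:ℝ)) s * g s
        = (∫ s in (0:ℝ)..b, g s) - ∫ s in (0:ℝ)..a, g s := by
    intro a b ha hab hb
    have he : (fun s => (Ioc a b).indicator (fun _ => (1:ℝ)) s * g s) = (Ioc a b).indicator g := by
      ext s; by_cases h : s ∈ Ioc a b <;> simp [h]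
    rw [he]
    refine ⟨hgi.indicator measurableSet_Ioc, ?_⟩
    rw [integral_indicator measurableSet_Ioc, Measure.restrict_restrict measurableSet_Ioc,
      inter_eq_left.2 (show Ioc a b ⊆ Icc 0 T from fun s hs => ⟨ha.trans hs.1.le, hs.2.trans hb⟩),
      ← intervalIntegral.integral_of_le hab,
      intervalIntegral.integral_interval_sub_left (hgI _ _ le_rfl (ha.trans hab) hb)
        (hgI _ _ le_rfl ha (hab.trans hb))]
  obtain ⟨i1, e1⟩ := hgv x y hx.1 hxy.le (hyz.le.trans hz.2)
  obtain ⟨i2, e2⟩ := hgv y z (hx.1.trans hxy.le) hyz.le hz.2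
  simp only [sub_mul, mul_assoc] at this
  rw [integral_sub (i1.const_mul _) (i2.const_mul _), integral_const_mul, integral_const_mul,
    e1, e2] at this
  rw [div_eq_inv_mul, div_eq_inv_mul]
  linarith

lemma tm_ptwise (T : ℝ) (G : ℝ → ℝ) (Gn : ℕ → ℝ → ℝ) (hGn : ∀ n, ConcaveOn ℝ (Icc 0 T) (Gn n))
    (hlim : ∀ t ∈ Icc 0 T, Tendsto (fun n => Gn n t) atTop (nhds (G t)))
    (t : ℝ) (ht : t ∈ Ioo 0 T) (d : ℝ) (dn : ℕ → ℝ) (hd : HasDerivAt G d t)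
    (hdn : ∀ n, HasDerivAt (Gn n) (dn n) t) : Tendsto dn atTop (nhds d) := by
  have htI : t ∈ Icc 0 T := ⟨ht.1.le, ht.2.le⟩
  have hsl := hasDerivAt_iff_tendsto_slope_left_right.1 hd
  have hconv : ∀ s ∈ Icc 0 T, Tendsto (fun n => slope (Gn n) t s) atTop (nhds (slope G t s)) := by
    intro s hs
    simp only [slope_def_field]
    exact ((hlim s hs).sub (hlim t htI)).div_const _
  rw [tendsto_order]
  constructor
  · intro a ha
    have h1 := hsl.2.eventually (lt_mem_nhds ha)
    have h2 : ∀ᶠ s in nhdsWithin t (Ioi t), s ∈ Ioo t T := Ioo_mem_nhdsGT ht.2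
    obtain ⟨s, hs1, hs2⟩ := (h1.and h2).exists
    have hsI : s ∈ Icc 0 T := ⟨ht.1.le.trans hs2.1.le, hs2.2.le⟩
    filter_upwards [(hconv s hsI).eventually (lt_mem_nhds hs1)] with n hn
    exact hn.trans_le ((hGn n).slope_le_of_hasDerivAt htI hsI hs2.1 (hdn n))
  · intro a ha
    have h1 := hsl.1.eventually (gt_mem_nhds ha)
    have h2 : ∀ᶠ s in nhdsWithin t (Iio t), s ∈ Ioo 0 t := Ioo_mem_nhdsLT ht.1
    obtain ⟨s, hs1, hs2⟩ := (h1.and h2).exists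
    have hsI : s ∈ Icc 0 T := ⟨hs2.1.le, hs2.2.le.trans ht.2.le⟩
    filter_upwards [(hconv s hsI).eventually (gt_mem_nhds hs1)] with n hn
    refine ((hGn n).le_slope_of_hasDerivAt hsI htI hs2.2 (hdn n)).trans_lt ?_
    rwa [slope_comm]

/-- convergence of primitives -/
lemma tm_prim (T c : ℝ) (hc : 0 ≤ c) (g : ℝ → ℝ) (gn : ℕ → ℝ → ℝ) (hg : Measurable g)
    (hg0 : ∀ t, 0 ≤ g t) (hgi : IntegrableOn g (Icc 0 T))
    (hgb : ∀ᵐ t ∂(volume.restrict (Icc 0 T)), g t ≤ c)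
    (hgn0 : ∀ n t, 0 ≤ gn n t) (hgni : ∀ n, IntegrableOn (gn n) (Icc 0 T))
    (hgnb : ∀ n, ∀ᵐ t ∂(volume.restrict (Icc 0 T)), gn n t ≤ c)
    (hw : ∀ h : ℝ → ℝ, Continuous h → (∃ M, ∀ t, |h t| ≤ M) →
      Tendsto (fun n => ∫ t in Icc 0 T, h t * gn n t) atTop (nhds (∫ t in Icc 0 T, h t * g t)))
    (t : ℝ) (ht : t ∈ Icc 0 T) :
    Tendsto (fun n => ∫ s in (0:ℝ)..t, gn n s) atTop (nhds (∫ s in (0:ℝ)..t, g s)) := by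
  have hrep : ∀ f : ℝ → ℝ, ∫ s in (0:ℝ)..t, f s
      = ∫ s in Icc 0 T, (Ioc 0 t).indicator (fun _ => (1:ℝ)) s * f s := by
    intro f
    have he : (fun s => (Ioc 0 t).indicator (fun _ => (1:ℝ)) s * f s) = (Ioc 0 t).indicator f := by
      ext s; by_cases h : s ∈ Ioc 0 t <;> simp [h]
    rw [he, integral_indicator measurableSet_Ioc, Measure.restrict_restrict measurableSet_Ioc,
      inter_eq_left.2 (show Ioc 0 t ⊆ Icc 0 T from fun s hs => ⟨hs.1.le, hs.2.trans ht.2⟩),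
      ← intervalIntegral.integral_of_le ht.1]
  simp only [hrep]
  set h := (Ioc 0 t).indicator (fun _ => (1:ℝ)) with hh
  have hhm : Measurable h := measurable_const.indicator measurableSet_Ioc
  have hh1 : ∀ s, |h s| ≤ 1 := fun s => by by_cases h' : s ∈ Ioc 0 t <;> simp [hh, h']
  rw [Metric.tendsto_atTop]
  intro e he
  have hpos : 0 < e / (4 * (c + 1)) := by positivity
  obtain ⟨h', hc', ⟨M', hM'⟩, hle⟩ := tm_approx (volume.restrict (Icc 0 T)) (fun _ => 0)
    measurable_const (fun _ => le_rfl) (integrable_zero _ _ _) h hhm 1 hh1 _ hpos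
  simp only [add_zero, mul_one] at hle
  have hdm : Measurable (fun t => h t - h' t) := hhm.sub hc'.measurable
  have hdb : ∀ t, ‖h t - h' t‖ ≤ 1 + M' := fun t =>
    (norm_sub_le _ _).trans (add_le_add (hh1 t) (hM' t))
  have hdi : Integrable (fun t => h t - h' t) (volume.restrict (Icc 0 T)) :=
    Integrable.of_bound hdm.aestronglyMeasurable (1 + M') (by filter_upwards with t using hdb t)
  have hest : ∀ f : ℝ → ℝ, (∀ t, 0 ≤ f t) → IntegrableOn f (Icc 0 T) →
      (∀ᵐ t ∂(volume.restrict (Icc 0 T)), f t ≤ c) →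
      |(∫ t in Icc 0 T, h t * f t) - ∫ t in Icc 0 T, h' t * f t| ≤ e / 4 := by
    intro f hf0 hfi hfb
    have i1 : Integrable (fun t => h t * f t) (volume.restrict (Icc 0 T)) :=
      Integrable.bdd_mul (c := 1) hfi hhm.aestronglyMeasurable (by filter_upwards with t using hh1 t)
    have i2 : Integrable (fun t => h' t * f t) (volume.restrict (Icc 0 T)) :=
      Integrable.bdd_mul (c := M') hfi hc'.measurable.aestronglyMeasurable (by
        filter_upwards with t using hM' t)
    rw [← integral_sub i1 i2]
    refine abs_integral_le_integral_abs.trans ?_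
    have : ∫ t in Icc 0 T, |h t * f t - h' t * f t| ≤ ∫ t in Icc 0 T, c * |h t - h' t| := by
      apply integral_mono_ae (i1.sub i2).abs (hdi.abs.const_mul c)
      filter_upwards [hfb] with s hs
      show |h s * f s - h' s * f s| ≤ c * |h s - h' s|
      rw [← sub_mul, abs_mul, abs_of_nonneg (hf0 s), mul_comm]
      exact mul_le_mul_of_nonneg_right hs (abs_nonneg _)
    refine this.trans ?_
    rw [integral_const_mul]
    calc _ ≤ c * (e / (4 * (c+1))) := by gcongr
      _ ≤ (c+1) * (e / (4 * (c+1))) := by gcongr; linarith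
      _ = e / 4 := by field_simp
  obtain ⟨N, hN⟩ := Metric.tendsto_atTop.1 (hw h' hc' ⟨M', hM'⟩) (e/4) (by positivity)
  refine ⟨N, fun n hn => ?_⟩
  have a1 := hest g hg0 hgi hgb
  have a2 := hest (gn n) (hgn0 n) (hgni n) (hgnb n)
  have a3 := hN n hn
  rw [Real.dist_eq] at a3 ⊢
  rw [abs_le] at a1 a2
  rw [abs_lt] at a3 ⊢
  constructor <;> linarith

lemma tm_prop_of_adm (T k θ : ℝ) (b : ℝ → ℝ) (S : Set ℝ) (m₀ : Measure ℝ)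
    (m : ℝ → Measure ℝ) (hm : FPineq T k θ b S m₀ m) :
    TMProp T (m₀ Set.univ).toReal (fun t => (m t Set.univ).toReal) := by
  intro f f' hc hd h0
  have hf : Continuous f := continuous_iff_continuousAt.2 fun t => (hd t).continuousAt
  have hb : ∃ M : ℝ, ∀ t ∈ Icc (0:ℝ) T, |f' t| ≤ M := by
    obtain ⟨M, hM⟩ := (isCompact_Icc (a := (0:ℝ)) (b := T)).exists_bound_of_continuousOn hc.continuousOn
    exact ⟨M, hM⟩
  obtain ⟨M, hM⟩ := hb
  have := hm (fun t _ => f t) (fun t _ => f' t) (fun _ _ => 0) (fun _ _ => 0)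
    (hf.comp continuous_fst).continuousOn (hc.comp continuous_fst).continuousOn
    continuousOn_const continuousOn_const (fun t _ x _ => hd t)
    (fun t _ x _ => hasDerivAt_const _ _) (fun t _ x _ => hasDerivAt_const _ _)
    (fun t ht x _ => h0 t ht) ⟨M, fun t ht x _ => by simpa [gen] using hM t ht⟩
  simp only [gen, mul_zero, add_zero, integral_const, smul_eq_mul, Measure.real] at this
  simpa only [mul_comm] using this

/-- along a weakly converging sequence in `A(ω₀)`, a subsequence of the
total-mass functions `t ↦ ωⁿ_t(Ω)` converges in `L¹([0,T])` to `t ↦ ω_t(Ω)`. -/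
theorem total_mass_L1_convergence
    (T k θ δ : ℝ) (hT : 0 < T) (hk : 0 < k) (hθ : 0 < θ) (hδ : 0 < δ)
    (ω₀ : Measure ℝ) (hω₀fin : IsFiniteMeasure ω₀) (hω₀supp : ω₀ (Ici (0:ℝ))ᶜ = 0)
    (ωseq : ℕ → ℝ → Measure ℝ) (hωseq : ∀ n, AdmC T k θ δ ω₀ (ωseq n))
    (ω : ℝ → Measure ℝ) (hω : AdmC T k θ δ ω₀ ω)
    (hconv : WeakConvFlow T ωseq ω) :
    ∃ φ : ℕ → ℕ, StrictMono φ ∧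
      Tendsto (fun q => ∫ t in Icc (0:ℝ) T,
          |(ωseq (φ q) t Set.univ).toReal - (ω t Set.univ).toReal|)
        atTop (nhds 0) := by
  refine ⟨id, strictMono_id, ?_⟩
  set c := (ω₀ Set.univ).toReal
  have hc : 0 ≤ c := ENNReal.toReal_nonneg
  set g : ℝ → ℝ := fun t => (ω t Set.univ).toReal with hgdef
  set gn : ℕ → ℝ → ℝ := fun n t => (ωseq n t Set.univ).toReal with hgndef
  have hP : TMProp T c g := tm_prop_of_adm _ _ _ _ _ _ _ hω.2
  have hPn : ∀ n, TMProp T c (gn n) := fun n => tm_prop_of_adm _ _ _ _ _ _ _ (hωseq n).2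
  have hg : Measurable g := (hω.1.2.2.1 _ MeasurableSet.univ).ennreal_toReal
  have hgn : ∀ n, Measurable (gn n) :=
    fun n => ((hωseq n).1.2.2.1 _ MeasurableSet.univ).ennreal_toReal
  have hg0 : ∀ t, 0 ≤ g t := fun t => ENNReal.toReal_nonneg
  have hgn0 : ∀ n t, 0 ≤ gn n t := fun n t => ENNReal.toReal_nonneg
  have hgi : IntegrableOn g (Icc 0 T) := hω.1.2.2.2
  have hgni : ∀ n, IntegrableOn (gn n) (Icc 0 T) := fun n => (hωseq n).1.2.2.2
  have hgb := tm_bound T c hc g hg hg0 hgi hP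
  have hgnb := fun n => tm_bound T c hc (gn n) (hgn n) (hgn0 n) (hgni n) (hPn n)
  have hw : ∀ h : ℝ → ℝ, Continuous h → (∃ M, ∀ t, |h t| ≤ M) →
      Tendsto (fun n => ∫ t in Icc 0 T, h t * gn n t) atTop (nhds (∫ t in Icc 0 T, h t * g t)) := by
    rintro h hcont ⟨M, hM⟩
    have := hconv (fun p => h p.1) (hcont.comp continuous_fst) ⟨M, fun p => hM p.1⟩
    simp only [integral_const, smul_eq_mul, Measure.real] at this
    simpa only [mul_comm, hgdef, hgndef] using this
  have hprim := tm_prim T c hc g gn hg hg0 hgi hgb hgn0 hgni hgnb hw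
  have hcc := fun n => tm_concave T c hc (gn n) (hgn n) (hgn0 n) (hgni n) (hPn n)
  have hder : ∀ f : ℝ → ℝ, IntegrableOn f (Icc 0 T) →
      ∀ᵐ t, t ∈ Ioo 0 T → HasDerivAt (fun t => ∫ s in (0:ℝ)..t, f s) (f t) t := by
    intro f hf
    have : IntervalIntegrable f volume 0 T := by
      rw [intervalIntegrable_iff_integrableOn_Icc_of_le hT.le]; exact hf
    filter_upwards [this.ae_hasDerivAt_integral] with t ht htI
    rw [uIcc_of_le hT.le] at ht
    exact ht ⟨htI.1.le, htI.2.le⟩ 0 ⟨le_rfl, hT.le⟩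
  have hae : ∀ᵐ t ∂(volume.restrict (Icc 0 T)), Tendsto (fun n => gn n t) atTop (nhds (g t)) := by
    rw [Measure.restrict_congr_set Ioo_ae_eq_Icc.symm, ae_restrict_iff' measurableSet_Ioo]
    filter_upwards [hder g hgi, ae_all_iff.2 fun n => hder (gn n) (hgni n)] with t h1 h2 ht
    exact tm_ptwise T _ _ hcc hprim t ht _ _ (h1 ht) (fun n => h2 n ht)
  have := tendsto_integral_of_dominated_convergence (μ := volume.restrict (Icc 0 T))
    (F := fun n t => |gn n t - g t|) (f := fun _ => 0) (fun _ => 2 * c)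
    (fun n => ((hgn n).sub hg).abs.aestronglyMeasurable) (integrable_const _)
    (fun n => by
      filter_upwards [hgb, hgnb n] with t h1 h2
      have := hg0 t
      have := hgn0 n t
      rw [Real.norm_eq_abs, abs_abs, abs_le]
      constructor <;> linarith)
    (by
      filter_upwards [hae] with t ht
      have := (ht.sub_const (g t)).abs
      simpa using this)
  simpa using this

end
end
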